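/- arXiv:1512.00273 — 2 statements merged into one kernel-verified Lean document; each statement's English description precedes it below -/
import Mathlib

section
/- Let M be a finitely generated Λ-module of rank one, i.e., M ⊗_Λ Frac(Λ) is a one-dimensional vector space over the fraction field Frac(Λ). Then the double dual M** = Hom_Λ(Hom_Λ(M,Λ),Λ) is a free Λ-module (necessarily of rank one). -/
open CategoryTheory Opposite

set_option maxHeartbeats 1000000
set_option synthInstance.maxHeartbeats 400000

noncomputable section

/-- The valuation ring of a finite extension `K` of `ℚ_p`, realized as the integral
closure of `ℤ_p` in `K`. -/
abbrev PadicValRing (p : ℕ) [Fact p.Prime] (K : Type) [Field K] [Algebra ℚ_[p] K]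
    [Algebra ℤ_[p] K] [IsScalarTower ℤ_[p] ℚ_[p] K] : Type :=
  integralClosure ℤ_[p] K

/-- The formal power series ring `Λ = O⟦t₁, …, t_r⟧` over the valuation ring `O`. -/
abbrev IwasawaAlgebra (p : ℕ) [Fact p.Prime] (K : Type) [Field K] [Algebra ℚ_[p] K]
    [Algebra ℤ_[p] K] [IsScalarTower ℤ_[p] ℚ_[p] K] (r : ℕ) : Type :=
  MvPowerSeries (Fin r) (PadicValRing p K)

/-- `Ext^i_R(M, N)`, as a type (carrying its natural `R`-module structure). -/
abbrev ExtGroup (R : Type) [CommRing R] (i : ℕ) (M N : Type) [AddCommGroup M] [Module R M]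
    [AddCommGroup N] [Module R N] : Type :=
  ((Ext R (ModuleCat R) i).obj (op (ModuleCat.of R M))).obj (ModuleCat.of R N)

/-- The height of an ideal: the infimum of the heights of the prime ideals containing it. -/
noncomputable def idealHeight {R : Type} [CommRing R] (I : Ideal R) : ℕ∞ :=
  ⨅ P : {P : PrimeSpectrum R // I ≤ P.asIdeal}, Order.height P.1

theorem adic_mono {R : Type*} [CommRing R] {I J : Ideal R} (hIJ : I ≤ J) (e : ℕ) (he : 1 ≤ e)
    (hJ : J ^ e ≤ I) [IsAdicComplete I R] : IsAdicComplete J R := by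
  have H : ∀ n, J ^ (e * n) ≤ I ^ n := fun n => by
    rw [pow_mul]; exact Ideal.pow_right_mono hJ n
  have h1 : IsHausdorff J R := ⟨fun x hx => by
    apply IsHausdorff.haus (I := I) inferInstance
    intro n
    have := hx (e * n)
    rw [SModEq.zero, smul_eq_mul, Ideal.mul_top] at this ⊢
    exact H n this⟩
  have h2 : IsPrecomplete J R := ⟨fun f hf => by
    obtain ⟨L, hL⟩ := IsPrecomplete.prec' (I := I) (fun n => f (e * n)) (by
      intro m n hmn
      have := hf (Nat.mul_le_mul_left e hmn)
      rw [SModEq.sub_mem, smul_eq_mul, Ideal.mul_top] at this ⊢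
      exact H m this)
    refine ⟨L, fun n => ?_⟩
    have a1 := hL n
    have a2 := hf (Nat.le_mul_of_pos_left n he)
    refine a2.trans ?_
    rw [SModEq.sub_mem, smul_eq_mul, Ideal.mul_top] at a1 ⊢
    exact Ideal.pow_right_mono hIJ n a1⟩
  exact { h1, h2 with }

open PowerSeries in
theorem ps_mem_max_pow {A : Type*} [CommRing A] [IsLocalRing A] (n : ℕ) (f : A⟦X⟧) :
    f ∈ (IsLocalRing.maximalIdeal A⟦X⟧) ^ n ↔
      ∀ i, coeff i f ∈ (IsLocalRing.maximalIdeal A) ^ (n - i) := by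
  have hX : (X : A⟦X⟧) ∈ IsLocalRing.maximalIdeal A⟦X⟧ := by
    rw [IsLocalRing.mem_maximalIdeal, mem_nonunits_iff, isUnit_iff_constantCoeff]; simp
  have hC : (IsLocalRing.maximalIdeal A).map (C (R := A)) ≤ IsLocalRing.maximalIdeal A⟦X⟧ := by
    rw [Ideal.map_le_iff_le_comap]
    intro a ha
    rw [Ideal.mem_comap, IsLocalRing.mem_maximalIdeal, mem_nonunits_iff, isUnit_iff_constantCoeff]
    simpa using ha
  constructor
  · intro hf
    induction n generalizing f with
    | zero => intro i; simp
    | succ n ih =>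
      rw [pow_succ] at hf
      induction hf using Submodule.mul_induction_on' with
      | mem_mul_mem a ha b hb =>
        intro i
        rw [coeff_mul]
        refine Ideal.sum_mem _ fun x hx => ?_
        have hx' := Finset.HasAntidiagonal.mem_antidiagonal.1 hx
        have h1 := ih a ha x.1
        by_cases h0 : x.2 = 0
        · have hb0 : coeff x.2 b ∈ IsLocalRing.maximalIdeal A := by
            rw [h0]
            rw [IsLocalRing.mem_maximalIdeal, mem_nonunits_iff, isUnit_iff_constantCoeff] at hb
            simpa using hb
          have := Ideal.mul_mem_mul h1 hb0
          rw [← pow_succ] at this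
          exact Ideal.pow_le_pow_right (by omega) this
        · exact Ideal.mul_mem_right _ _ (Ideal.pow_le_pow_right (by omega) h1)
      | add a _ b _ ha hb => intro i; rw [map_add]; exact Ideal.add_mem _ (ha i) (hb i)
  · intro hf
    have key : ∀ k (g : A⟦X⟧), (∀ i, coeff i g ∈ (IsLocalRing.maximalIdeal A) ^ (k - i)) →
        g ∈ (IsLocalRing.maximalIdeal A⟦X⟧) ^ k := by
      intro k
      induction k with
      | zero => intro g _; simp
      | succ k ih =>
        intro g hg
        have hd := g.sub_const_eq_X_mul_shift
        have : g = X * (mk fun p => coeff (p+1) g) + C (constantCoeff g) := by rw [← hd]; ring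
        rw [this]
        refine Ideal.add_mem _ ?_ ?_
        · rw [pow_succ']
          refine Ideal.mul_mem_mul hX (ih _ fun i => ?_)
          rw [coeff_mk]
          have := hg (i+1)
          rwa [Nat.add_sub_add_right] at this
        · have := hg 0
          rw [Nat.sub_zero, coeff_zero_eq_constantCoeff_apply] at this
          have := Ideal.mem_map_of_mem (C (R := A)) this
          rw [Ideal.map_pow] at this
          exact Ideal.pow_right_mono hC _ this
    exact key n f hf

open PowerSeries in
theorem ps_adic {A : Type*} [CommRing A] [IsLocalRing A]
    [IsAdicComplete (IsLocalRing.maximalIdeal A) A] :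
    IsAdicComplete (IsLocalRing.maximalIdeal A⟦X⟧) A⟦X⟧ := by
  have h1 : IsHausdorff (IsLocalRing.maximalIdeal A⟦X⟧) A⟦X⟧ := ⟨fun x hx => by
    ext i
    rw [map_zero]
    apply IsHausdorff.haus (I := IsLocalRing.maximalIdeal A) inferInstance
    intro n
    have := hx (n + i)
    rw [SModEq.zero, smul_eq_mul, Ideal.mul_top] at this ⊢
    simpa using (ps_mem_max_pow _ _).1 this i⟩
  have h2 : IsPrecomplete (IsLocalRing.maximalIdeal A⟦X⟧) A⟦X⟧ := ⟨fun f hf => by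
    have : ∀ i, ∃ L, ∀ n, coeff i (f (n + i)) - L ∈ (IsLocalRing.maximalIdeal A) ^ n := by
      intro i
      obtain ⟨L, hL⟩ := IsPrecomplete.prec' (I := IsLocalRing.maximalIdeal A)
        (fun n => coeff i (f (n + i))) (by
        intro m n hmn
        have := hf (Nat.add_le_add_right hmn i)
        rw [SModEq.sub_mem, smul_eq_mul, Ideal.mul_top] at this ⊢
        simpa using (ps_mem_max_pow _ _).1 this i)
      refine ⟨L, fun n => ?_⟩
      have := hL n
      rwa [SModEq.sub_mem, smul_eq_mul, Ideal.mul_top] at this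
    choose L hL using this
    refine ⟨mk L, fun n => ?_⟩
    rw [SModEq.sub_mem, smul_eq_mul, Ideal.mul_top, ps_mem_max_pow]
    intro i
    rcases le_total i n with h | h
    · have := hL i (n - i)
      rw [Nat.sub_add_cancel h] at this
      simpa using this
    · rw [Nat.sub_eq_zero_of_le h]; simp⟩
  exact { h1, h2 with }

theorem adic_equiv {R S : Type*} [CommRing R] [CommRing S] [IsLocalRing R] [IsLocalRing S]
    (e : R ≃+* S) (h : IsAdicComplete (IsLocalRing.maximalIdeal R) R) :
    IsAdicComplete (IsLocalRing.maximalIdeal S) S := by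
  have := (IsAdicComplete.congr_ringEquiv (I := IsLocalRing.maximalIdeal R) e).2 h
  convert this
  exact (IsLocalRing.eq_maximalIdeal (Ideal.map_isMaximal_of_equiv e)).symm

theorem mv_adic {O : Type*} [CommRing O] [IsLocalRing O]
    [IsAdicComplete (IsLocalRing.maximalIdeal O) O] (r : ℕ) :
    IsAdicComplete (IsLocalRing.maximalIdeal (MvPowerSeries (Fin r) O)) (MvPowerSeries (Fin r) O) := by
  induction r with
  | zero => exact adic_equiv (MvPowerSeries.isEmptyEquiv (Fin 0) O).toRingEquiv.symm inferInstance
  | succ n ih => exact adic_equiv (MvPowerSeries.finSuccEquiv O n).toRingEquiv.symm ps_adic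

open PowerSeries in
theorem weier_prime {A : Type*} [CommRing A] [IsDomain A] [IsLocalRing A]
    [UniqueFactorizationMonoid A]
    [IsAdicComplete (IsLocalRing.maximalIdeal A) A] (P : Ideal A⟦X⟧) [P.IsPrime]
    (g : A⟦X⟧) (hg : g ∈ P) (hg0 : g.map (IsLocalRing.residue A) ≠ 0) :
    ∃ q ∈ P, Prime q := by
  obtain ⟨h, u, H⟩ := exists_isWeierstrassFactorization hg0
  have hd := H.isDistinguishedAt
  have hhP : (h : A⟦X⟧) ∈ P := by
    rw [H.eq_mul] at hg
    exact (Ideal.IsPrime.mem_or_mem ‹_› hg).resolve_right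
      fun h' => Ideal.IsPrime.ne_top ‹_› (Ideal.eq_top_of_isUnit_mem _ h' H.isUnit)
  let Q : Ideal (Polynomial A) := P.comap Polynomial.coeToPowerSeries.ringHom
  have hQ : Q.IsPrime := Ideal.comap_isPrime _ _
  have hhQ : h ∈ Q := hhP
  obtain ⟨s, hs, v, hsv⟩ := UniqueFactorizationMonoid.exists_prime_factors h hd.monic.ne_zero
  have hsQ : s.prod ∈ Q := by
    rw [← hsv] at hhQ
    exact (hQ.mem_or_mem hhQ).resolve_right
      fun h' => hQ.ne_top (Ideal.eq_top_of_isUnit_mem _ h' v.isUnit)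
  obtain ⟨q, hqs, hqQ⟩ := (Ideal.IsPrime.multiset_prod_mem_iff_exists_mem hQ s).1 hsQ
  have hqp := hs q hqs
  have hqh : q ∣ h := (Multiset.dvd_prod hqs).trans ⟨v, hsv.symm⟩
  obtain ⟨t, ht⟩ := hqh
  have hlc : q.leadingCoeff * t.leadingCoeff = 1 := by
    rw [← Polynomial.leadingCoeff_mul, ← ht]; exact hd.monic
  set q' := q * Polynomial.C t.leadingCoeff with hq'
  have huC : IsUnit (Polynomial.C t.leadingCoeff) :=
    Polynomial.isUnit_C.2 (IsUnit.of_mul_eq_one q.leadingCoeff (by rw [mul_comm]; exact hlc))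
  have hq'p : Prime q' := by
    refine (Associated.prime_iff ?_).1 hqp
    exact ⟨huC.unit, rfl⟩
  have hq'm : q'.Monic := by
    rw [Polynomial.Monic, hq', Polynomial.leadingCoeff_mul, Polynomial.leadingCoeff_C, hlc]
  have hq'h : q' ∣ h := by
    rw [hq']
    refine (huC.mul_right_dvd).2 ⟨t, ht⟩
  have hq'd : q'.IsDistinguishedAt (IsLocalRing.maximalIdeal A) := by
    have h1 : q'.map (IsLocalRing.residue A) ∣ Polynomial.X ^ h.natDegree := by
      have := Polynomial.map_dvd (IsLocalRing.residue A) hq'h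
      have h2 := hd.map_eq_X_pow
      change Polynomial.map (IsLocalRing.residue A) h = _ at h2
      rwa [h2] at this
    obtain ⟨j, hj, hja⟩ := (dvd_prime_pow Polynomial.prime_X _).1 h1
    have h3 := Polynomial.eq_of_monic_of_associated (hq'm.map _) (Polynomial.monic_X_pow j) hja
    have h4 : q'.natDegree = j := by
      have := congrArg Polynomial.natDegree h3
      rwa [hq'm.natDegree_map, Polynomial.natDegree_X_pow] at this
    refine ⟨⟨fun {i} hi => ?_⟩, hq'm⟩
    have := congrArg (fun p => Polynomial.coeff p i) h3
    simp only [Polynomial.coeff_map, Polynomial.coeff_X_pow] at this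
    rw [if_neg (by omega)] at this
    exact (IsLocalRing.residue_eq_zero_iff _).1 this
  refine ⟨(q' : A⟦X⟧), ?_, ?_⟩
  · have : q' ∈ Q := Ideal.mul_mem_right _ _ hqQ
    exact this
  · have hne : (q' : A⟦X⟧) ≠ 0 := by
      simpa using hq'm.ne_zero
    rw [← Ideal.span_singleton_prime hne, ← Ideal.Quotient.isDomain_iff_prime]
    have : IsDomain (Polynomial A ⧸ Ideal.span {q'}) :=
      (Ideal.Quotient.isDomain_iff_prime _).2 ((Ideal.span_singleton_prime hq'm.ne_zero).2 hq'p)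
    exact hq'd.algEquivQuotient.symm.toMulEquiv.isDomain _

theorem weights (r : ℕ) (S : Set (Fin (r+1) → ℕ)) (hS : S.Nonempty) :
    ∃ n : Fin (r+1) → ℕ, (∀ i, 1 ≤ n i) ∧ n 0 = 1 ∧ ∃ m ∈ S, ∀ d ∈ S, d ≠ m →
      ∑ i, n i * m i < ∑ i, n i * d i := by
  induction r with
  | zero =>
    obtain ⟨m, hm, hmin⟩ := WellFounded.has_min (InvImage.wf (fun d : Fin 1 → ℕ => d 0) wellFounded_lt) S hS
    refine ⟨fun _ => 1, fun _ => le_rfl, rfl, m, hm, fun d hd hne => ?_⟩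
    have := hmin d hd
    simp only [InvImage, not_lt] at this
    have h2 : d 0 ≠ m 0 := fun h => hne (by ext i; obtain rfl : i = 0 := Fin.fin_one_eq_zero i; exact h)
    simp; omega
  | succ r ih =>
    -- split off the last variable
    obtain ⟨m₁, hm₁, hmin⟩ := WellFounded.has_min
      (InvImage.wf (fun d : Fin (r+2) → ℕ => d (Fin.last _)) wellFounded_lt) S hS
    set a := m₁ (Fin.last _)
    obtain ⟨n, hn1, hn0, m, hm, hlt⟩ := ih {d | Fin.snoc (α := fun _ => ℕ) d a ∈ S}
      ⟨Fin.init m₁, by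
        change Fin.snoc (Fin.init m₁) (m₁ (Fin.last _)) ∈ S
        rwa [Fin.snoc_init_self]⟩
    refine ⟨Fin.snoc (α := fun _ => ℕ) n (∑ i, n i * m i + 1), ?_, ?_, _, hm, ?_⟩
    · intro i; refine Fin.lastCases ?_ (fun i => ?_) i
      · simp
      · simpa using hn1 i
    · rw [← Fin.castSucc_zero, Fin.snoc_castSucc]; exact hn0
    · intro d hd hne
      rw [Fin.sum_univ_castSucc (n := r+1), Fin.sum_univ_castSucc (n := r+1)]
      simp only [Fin.snoc_castSucc, Fin.snoc_last]
      have h := hmin d hd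
      simp only [InvImage, not_lt] at h
      rcases h.eq_or_lt with h | h
      · have hd' : Fin.snoc (α := fun _ => ℕ) (Fin.init d) a = d := by
          change Fin.snoc (Fin.init d) (m₁ (Fin.last _)) = d
          rw [h, Fin.snoc_init_self]
        have := hlt (Fin.init d) (by change Fin.snoc _ _ ∈ S; rwa [hd'])
          (fun h' => hne (by rw [← h', hd']))
        simp only [Fin.init] at this
        change _ + _ * m₁ (Fin.last _) < _
        rw [h]
        omega
      · have : (∑ i, n i * m i + 1) * (a + 1) ≤ (∑ i, n i * m i + 1) * d (Fin.last _) :=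
          Nat.mul_le_mul_left _ h
        rw [mul_add] at this
        omega

theorem adic_free {R M ι : Type*} [CommRing R] [AddCommGroup M] [Module R M] [Fintype ι]
    (b : Module.Basis ι R M) (I : Ideal R) [IsAdicComplete I R] : IsAdicComplete I M := by
  have key : ∀ (J : Ideal R) (x : M), x ∈ J • (⊤ : Submodule R M) ↔ ∀ i, b.repr x i ∈ J := by
    intro J x
    constructor
    · intro hx
      refine Submodule.smul_induction_on hx ?_ ?_
      · intro r hr n _ i
        simpa using Ideal.mul_mem_right _ _ hr
      · intro x y hx hy i
        simpa using Ideal.add_mem _ (hx i) (hy i)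
    · intro h
      rw [← b.sum_repr x]
      exact Submodule.sum_mem _ fun i _ => Submodule.smul_mem_smul (h i) trivial
  have h1 : IsHausdorff I M := ⟨fun x hx => by
    apply b.repr.injective
    ext i
    rw [map_zero, Finsupp.zero_apply]
    apply IsHausdorff.haus (I := I) inferInstance
    intro n
    have := hx n
    rw [SModEq.zero, key] at this
    rw [SModEq.zero, smul_eq_mul, Ideal.mul_top]
    exact this i⟩
  have h2 : IsPrecomplete I M := ⟨fun f hf => by
    have : ∀ i, ∃ L, ∀ n, b.repr (f n) i - L ∈ I ^ n := by
      intro i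
      obtain ⟨L, hL⟩ := IsPrecomplete.prec' (I := I) (fun n => b.repr (f n) i) (by
        intro m n hmn
        have := hf hmn
        rw [SModEq.sub_mem, key] at this
        rw [SModEq.sub_mem, smul_eq_mul, Ideal.mul_top]
        simpa using this i)
      refine ⟨L, fun n => ?_⟩
      have := hL n
      rwa [SModEq.sub_mem, smul_eq_mul, Ideal.mul_top] at this
    choose L hL using this
    refine ⟨b.equivFun.symm L, fun n => ?_⟩
    rw [SModEq.sub_mem, key]
    intro i
    have := hL i n
    rw [map_sub, Finsupp.sub_apply]
    convert this
    have := congrFun (b.equivFun.apply_symm_apply L) i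
    simpa only [Module.Basis.equivFun_apply] using this⟩
  exact { h1, h2 with }

section
variable (p : ℕ) [Fact p.Prime] (K : Type) [Field K] [Algebra ℚ_[p] K]
    [Algebra ℤ_[p] K] [IsScalarTower ℤ_[p] ℚ_[p] K] [FiniteDimensional ℚ_[p] K]

theorem int_iff (x : K) : IsIntegral ℤ_[p] x ↔ spectralNorm ℚ_[p] K x ≤ 1 := by
  have hx : IsIntegral ℚ_[p] x := Algebra.IsIntegral.isIntegral x
  rw [spectralNorm, spectralValue_le_one_iff (minpoly.monic hx)]
  constructor
  · intro h n
    rw [minpoly.isIntegrallyClosed_eq_field_fractions' ℚ_[p] h, Polynomial.coeff_map]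
    exact (Polynomial.coeff (minpoly ℤ_[p] x) n).2
  · intro h
    have : minpoly ℚ_[p] x ∈ Polynomial.lifts (algebraMap ℤ_[p] ℚ_[p]) := by
      rw [Polynomial.lifts_iff_coeff_lifts]
      intro n
      exact ⟨⟨_, h n⟩, rfl⟩
    obtain ⟨q, hq, -, hqm⟩ := Polynomial.lifts_and_degree_eq_and_monic this (minpoly.monic hx)
    refine ⟨q, hqm, ?_⟩
    have h1 := minpoly.aeval ℚ_[p] x
    rw [← hq, Polynomial.aeval_map_algebraMap] at h1
    exact h1

theorem O_local : IsLocalRing (integralClosure ℤ_[p] K) := by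
  have hval : ∀ x : integralClosure ℤ_[p] K, spectralNorm ℚ_[p] K (x : K) ≤ 1 :=
    fun x => (int_iff p K _).1 x.2
  have hun : ∀ x : integralClosure ℤ_[p] K, 1 ≤ spectralNorm ℚ_[p] K (x : K) → IsUnit x := by
    intro x hx
    have hx0 : (x : K) ≠ 0 := by
      intro h
      rw [h, spectralNorm_zero] at hx
      norm_num at hx
    have hmul := spectralAlgNorm_mul (K := ℚ_[p]) (L := K) (x : K) (x : K)⁻¹
    rw [mul_inv_cancel₀ hx0, spectralAlgNorm_one] at hmul
    simp only [spectralAlgNorm_def] at hmul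
    have hinv : IsIntegral ℤ_[p] (x : K)⁻¹ := by
      rw [int_iff]
      have := spectralNorm_nonneg (K := ℚ_[p]) (x : K)⁻¹
      nlinarith
    exact IsUnit.of_mul_eq_one ⟨(x : K)⁻¹, hinv⟩ (Subtype.ext (mul_inv_cancel₀ hx0))
  refine IsLocalRing.of_isUnit_or_isUnit_one_sub_self fun a => ?_
  have h := isNonarchimedean_spectralNorm (K := ℚ_[p]) (L := K) (a : K) ((1 - a : integralClosure ℤ_[p] K) : K)
  have h1 : (a : K) + ((1 - a : integralClosure ℤ_[p] K) : K) = 1 := by push_cast; ring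
  rw [h1, spectralNorm_one, le_max_iff] at h
  exact h.imp (hun _) (hun _)

theorem O_finite : Module.Finite ℤ_[p] (integralClosure ℤ_[p] K) :=
  IsIntegralClosure.finite ℤ_[p] ℚ_[p] K _

theorem O_dedekind : IsDedekindDomain (integralClosure ℤ_[p] K) :=
  integralClosure.isDedekindDomain ℤ_[p] ℚ_[p] K

theorem O_props : IsDomain (integralClosure ℤ_[p] K) ∧ 
   IsPrincipalIdealRing (integralClosure ℤ_[p] K) ∧ ∃ _ : IsLocalRing (integralClosure ℤ_[p] K),
    IsAdicComplete (IsLocalRing.maximalIdeal (integralClosure ℤ_[p] K)) (integralClosure ℤ_[p] K) ∧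
    IsLocalRing.maximalIdeal (integralClosure ℤ_[p] K) ≠ ⊥ := by
  have hl := O_local p K
  have hd := O_dedekind p K
  have hf := O_finite p K
  have htf := tfae_of_isNoetherianRing_of_isLocalRing_of_isDomain (integralClosure ℤ_[p] K)
  have hpir : IsPrincipalIdealRing (integralClosure ℤ_[p] K) := (htf.out 0 2).2 hd
  have hinjK : Function.Injective (algebraMap ℤ_[p] K) := by
    rw [IsScalarTower.algebraMap_eq ℤ_[p] ℚ_[p] K]
    exact (algebraMap ℚ_[p] K).injective.comp (IsFractionRing.injective ℤ_[p] ℚ_[p])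
  have hinj : Function.Injective (algebraMap ℤ_[p] (integralClosure ℤ_[p] K)) := by
    intro a b hab
    exact hinjK (congrArg (fun x : integralClosure ℤ_[p] K => (x : K)) hab)
  have hfs : FaithfulSMul ℤ_[p] (integralClosure ℤ_[p] K) :=
    (faithfulSMul_iff_algebraMap_injective _ _).2 hinj
  have htor : Module.IsTorsionFree ℤ_[p] (integralClosure ℤ_[p] K) := inferInstance
  have hfree : Module.Free ℤ_[p] (integralClosure ℤ_[p] K) := inferInstance
  have hle : (IsLocalRing.maximalIdeal ℤ_[p]).map (algebraMap ℤ_[p] (integralClosure ℤ_[p] K)) ≤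
      IsLocalRing.maximalIdeal (integralClosure ℤ_[p] K) := by
    have : IsLocalHom (algebraMap ℤ_[p] (integralClosure ℤ_[p] K)) :=
      Algebra.IsIntegral.isLocalHom _ _
    exact ((IsLocalRing.local_hom_TFAE _).out 0 2).1 this
  have hne : (IsLocalRing.maximalIdeal ℤ_[p]).map (algebraMap ℤ_[p] (integralClosure ℤ_[p] K)) ≠ ⊥ := by
    intro h
    rw [Ideal.map_eq_bot_iff_of_injective hinj] at h
    exact IsDiscreteValuationRing.not_a_field ℤ_[p] h
  refine ⟨inferInstance, hpir, hl, ?_, fun h => hne (le_bot_iff.1 (h ▸ hle))⟩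
  have h1 : IsAdicComplete (IsLocalRing.maximalIdeal ℤ_[p]) (integralClosure ℤ_[p] K) :=
    adic_free (Module.Free.chooseBasis _ _) _
  rw [← IsAdicComplete.map_algebraMap_iff (S := integralClosure ℤ_[p] K)] at h1
  obtain ⟨e, he⟩ := ((htf.out 0 6).1 hpir : ∀ I ≠ ⊥, ∃ n : ℕ, I = IsLocalRing.maximalIdeal (integralClosure ℤ_[p] K) ^ n) _ hne
  have he' : IsLocalRing.maximalIdeal (integralClosure ℤ_[p] K) ^ (e + 1) ≤
      (IsLocalRing.maximalIdeal ℤ_[p]).map (algebraMap ℤ_[p] (integralClosure ℤ_[p] K)) := by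
    rw [he]; exact Ideal.pow_le_pow_right (by omega)
  exact adic_mono hle (e + 1) (by omega) he'
end

section shear
open MvPowerSeries
variable {O : Type*} [CommRing O] {r : ℕ}

/-- The images of the variables under the shear `X_i ↦ X_i + c * X_0 ^ n_i` (`i > 0`). -/
noncomputable def shearFun (c : O) (n : Fin (r+1) → ℕ) : Fin (r+1) → MvPowerSeries (Fin (r+1)) O :=
  Fin.cases (X 0) (fun i => X i.succ + C c * X 0 ^ n i.succ)

theorem shear_hasSubst (c : O) (n : Fin (r+1) → ℕ) (hn : ∀ i, 1 ≤ n i) :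
    HasSubst (shearFun c n) := by
  refine hasSubst_of_constantCoeff_zero fun s => ?_
  refine Fin.cases ?_ (fun i => ?_) s
  · simp [shearFun]
  · have := hn i.succ
    simp [shearFun, show n i.succ ≠ 0 by omega]

theorem shear_inv (c : O) (n : Fin (r+1) → ℕ) (hn : ∀ i, 1 ≤ n i)
    (f : MvPowerSeries (Fin (r+1)) O) :
    subst (shearFun (-c) n) (subst (shearFun c n) f) = f := by
  have h' := shear_hasSubst (-c) n hn
  rw [subst_comp_subst_apply (shear_hasSubst c n hn) h']
  have : (fun s => subst (shearFun (-c) n) (shearFun c n s)) = X := by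
    funext s
    refine Fin.cases ?_ (fun i => ?_) s
    · simp only [shearFun, Fin.cases_zero]
      rw [subst_X h']; simp [shearFun]
    · conv_lhs => rw [shearFun]
      simp only [Fin.cases_succ]
      rw [subst_add h', subst_mul h', subst_pow h', subst_X h', subst_X h', subst_C]
      simp [shearFun]
  rw [this, subst_self]; rfl

/-- The shear automorphism. -/
noncomputable def shear (n : Fin (r+1) → ℕ) (hn : ∀ i, 1 ≤ n i) :
    MvPowerSeries (Fin (r+1)) O ≃+* MvPowerSeries (Fin (r+1)) O :=
  RingEquiv.ofRingHom (substAlgHom (R := O) (shear_hasSubst 1 n hn)).toRingHom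
    (substAlgHom (R := O) (shear_hasSubst (-1) n hn)).toRingHom
    (by ext1 f
        have := shear_inv (-1) n hn f
        rw [neg_neg] at this
        simpa [substAlgHom_apply] using this)
    (by ext1 f
        simpa [substAlgHom_apply] using shear_inv 1 n hn f)

theorem shear_apply (n : Fin (r+1) → ℕ) (hn : ∀ i, 1 ≤ n i) (f : MvPowerSeries (Fin (r+1)) O) :
    shear n hn f = subst (shearFun 1 n) f := by
  rw [← substAlgHom_apply (shear_hasSubst 1 n hn)]; rfl

/-- Setting all variables but the zeroth to zero. -/
noncomputable def toPS : MvPowerSeries (Fin (r+1)) O →+* PowerSeries O :=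
  (PowerSeries.map constantCoeff).comp (finSuccEquiv O r).toRingEquiv.toRingHom

theorem toPS_apply (f : MvPowerSeries (Fin (r+1)) O) :
    toPS f = PowerSeries.map constantCoeff (finSuccEquiv O r f) := rfl

theorem coeff_toPS (f : MvPowerSeries (Fin (r+1)) O) (j : ℕ) :
    PowerSeries.coeff j (toPS f) = coeff (Finsupp.cons j 0) f := by
  rw [toPS_apply, PowerSeries.coeff_map, ← coeff_zero_eq_constantCoeff_apply,
    coeff_coeff_finSuccEquiv]

theorem toPS_shearFun (n : Fin (r+1) → ℕ) (hn0 : n 0 = 1) (i : Fin (r+1)) :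
    toPS (shearFun (1:O) n i) = PowerSeries.X ^ n i := by
  refine Fin.cases ?_ (fun i => ?_) i
  · simp [shearFun, toPS_apply, hn0]
  · simp [shearFun, toPS_apply]

theorem exists_shear [IsLocalRing O] (g : MvPowerSeries (Fin (r+1)) O)
    (hg : ∃ d, coeff d g ∉ IsLocalRing.maximalIdeal O) :
    ∃ σ : MvPowerSeries (Fin (r+1)) O ≃+* MvPowerSeries (Fin (r+1)) O,
      ∃ j, coeff (Finsupp.cons j 0) (σ g) ∉ IsLocalRing.maximalIdeal O := by
  classical
  obtain ⟨d₀, hd₀⟩ := hg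
  obtain ⟨n, hn, hn0, m, hm, hlt⟩ := weights r
    {d | coeff (Finsupp.equivFunOnFinite.symm d) g ∉ IsLocalRing.maximalIdeal O}
    ⟨Finsupp.equivFunOnFinite d₀, by simpa using hd₀⟩
  refine ⟨shear n hn, ∑ i, n i * m i, ?_⟩
  rw [shear_apply, coeff_subst (shear_hasSubst 1 n hn)]
  have hco : ∀ d : Fin (r+1) →₀ ℕ, coeff (Finsupp.cons (∑ i, n i * m i) 0)
      (d.prod fun s e => shearFun (1:O) n s ^ e) =
      if ∑ i, n i * m i = ∑ i, n i * d i then 1 else 0 := by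
    intro d
    rw [← coeff_toPS, map_finsuppProd]
    simp only [map_pow, toPS_shearFun n hn0]
    rw [Finsupp.prod_fintype _ _ (by simp)]
    simp only [← pow_mul]
    rw [Finset.prod_pow_eq_pow_sum, PowerSeries.coeff_X_pow]
  set m' := Finsupp.equivFunOnFinite.symm m with hm'
  have hfin := coeff_subst_finite (shear_hasSubst (1:O) n hn) g (Finsupp.cons (∑ i, n i * m i) 0)
  simp only [hco] at hfin ⊢
  intro hmem
  rw [finsum_eq_sum_of_support_subset (s := insert m' hfin.toFinset) _ (by
    intro x hx
    rw [Finset.coe_insert]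
    exact Or.inr ((Set.Finite.mem_toFinset _).2 hx))] at hmem
  rw [← Finset.add_sum_erase _ _ (Finset.mem_insert_self _ _)] at hmem
  have h2 := (Ideal.add_mem_iff_left _ (Ideal.sum_mem _ fun d hd => ?_)).1 hmem
  · apply hm
    have h3 : ∀ i, m' i = m i := fun i => rfl
    simpa [h3] using h2
  · have hne := Finset.ne_of_mem_erase hd
    split_ifs with h
    · by_contra hcon
      have := hlt (Finsupp.equivFunOnFinite d) (by simpa using hcon) (by
        intro h'; apply hne; rw [hm', ← h']; simp)
      simp only [Finsupp.equivFunOnFinite_apply] at this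
      omega
    · simp

end shear

theorem C_prime {O σ : Type*} [CommRing O] (π : O) (hπ : Prime π) :
    (∀ f : MvPowerSeries σ O, MvPowerSeries.C π ∣ f ↔ ∀ d, π ∣ MvPowerSeries.coeff d f) ∧
    Prime (MvPowerSeries.C π : MvPowerSeries σ O) := by
  have h1 : ∀ f : MvPowerSeries σ O, MvPowerSeries.C π ∣ f ↔ ∀ d, π ∣ MvPowerSeries.coeff d f := by
    intro f
    constructor
    · rintro ⟨g, rfl⟩ d
      rw [MvPowerSeries.coeff_C_mul]; exact dvd_mul_right _ _
    · intro h
      choose g hg using h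
      refine ⟨(show MvPowerSeries σ O from g), ?_⟩
      ext d
      rw [MvPowerSeries.coeff_C_mul, hg d]; rfl
  refine ⟨h1, ?_⟩
  have hpr : (Ideal.span {π}).IsPrime := (Ideal.span_singleton_prime hπ.ne_zero).2 hπ
  have h2 : ∀ f : MvPowerSeries σ O, MvPowerSeries.C π ∣ f ↔
      MvPowerSeries.map (Ideal.Quotient.mk (Ideal.span {π})) f = 0 := by
    intro f
    rw [h1, MvPowerSeries.ext_iff]
    refine forall_congr' fun d => ?_
    rw [MvPowerSeries.coeff_map, MvPowerSeries.coeff_zero, Ideal.Quotient.eq_zero_iff_mem,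
      Ideal.mem_span_singleton]
  refine ⟨fun h => hπ.ne_zero ?_, fun h => hπ.not_isUnit ?_, fun a b hab => ?_⟩
  · simpa using congrArg MvPowerSeries.constantCoeff h
  · simpa using h.map (MvPowerSeries.constantCoeff (σ := σ) (R := O))
  · rw [h2, map_mul, mul_eq_zero, ← h2, ← h2] at hab
    exact hab

theorem mv_domain {O σ : Type*} [CommRing O] [IsDomain O] : IsDomain (MvPowerSeries σ O) :=
  NoZeroDivisors.to_isDomain _

theorem mv_ufd {O : Type*} [CommRing O] [IsDomain O] [IsPrincipalIdealRing O] [IsLocalRing O]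
    [IsAdicComplete (IsLocalRing.maximalIdeal O) O] (hO : IsLocalRing.maximalIdeal O ≠ ⊥) (r : ℕ) :
    UniqueFactorizationMonoid (MvPowerSeries (Fin r) O) := by
  obtain ⟨π, hπ⟩ := (IsPrincipalIdealRing.principal (IsLocalRing.maximalIdeal O)).principal
  change _ = Ideal.span {π} at hπ
  have hπ0 : π ≠ 0 := by rintro rfl; apply hO; rw [hπ]; simp
  have hπp : Prime π := by
    rw [← Ideal.span_singleton_prime hπ0, ← hπ]; infer_instance
  induction r with
  | zero =>
    exact (MvPowerSeries.isEmptyEquiv (Fin 0) O).symm.toMulEquiv.uniqueFactorizationMonoid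
      inferInstance
  | succ r ih =>
    have hdom1 := mv_domain (O := O) (σ := Fin (r+1))
    have hdom := mv_domain (O := O) (σ := Fin r)
    rw [UniqueFactorizationMonoid.iff_exists_prime_mem_of_isPrime]
    intro P hP0 hP
    obtain ⟨hdvd, hCp⟩ := C_prime (σ := Fin (r+1)) π hπp
    by_cases hπP : MvPowerSeries.C π ∈ P
    · exact ⟨_, hπP, hCp⟩
    obtain ⟨f, hf, hf0⟩ := Submodule.exists_mem_ne_zero_of_ne_bot hP0
    have hfm : FiniteMultiplicity (MvPowerSeries.C π) f :=
      FiniteMultiplicity.of_not_isUnit hCp.not_isUnit hf0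
    obtain ⟨g, hg, hndvd⟩ := hfm.exists_eq_pow_mul_and_not_dvd
    have hgP : g ∈ P := by
      rw [hg] at hf
      exact (hP.mem_or_mem hf).resolve_left fun h => hπP (hP.mem_of_pow_mem _ h)
    have hg' : ∃ d, MvPowerSeries.coeff d g ∉ IsLocalRing.maximalIdeal O := by
      rw [hdvd] at hndvd
      push Not at hndvd
      obtain ⟨d, hd⟩ := hndvd
      exact ⟨d, by rwa [hπ, Ideal.mem_span_singleton]⟩
    obtain ⟨σ, j, hj⟩ := exists_shear g hg'
    have := mv_adic (O := O) r
    let e : MvPowerSeries (Fin (r+1)) O ≃+* PowerSeries (MvPowerSeries (Fin r) O) :=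
      σ.trans (MvPowerSeries.finSuccEquiv O r).toRingEquiv
    let P' : Ideal (PowerSeries (MvPowerSeries (Fin r) O)) := P.comap e.symm
    have hP' : P'.IsPrime := Ideal.comap_isPrime _ _
    obtain ⟨q, hq, hqp⟩ := weier_prime P' (e g)
      (by change e.symm (e g) ∈ P; simpa using hgP)
      (by
        intro h
        have := congrArg (PowerSeries.coeff j) h
        rw [PowerSeries.coeff_map, map_zero, IsLocalRing.residue_eq_zero_iff] at this
        rw [IsLocalRing.mem_maximalIdeal, mem_nonunits_iff, not_not] at hj
        refine this ?_
        rw [MvPowerSeries.isUnit_iff_constantCoeff, ← MvPowerSeries.coeff_zero_eq_constantCoeff_apply]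
        change IsUnit (MvPowerSeries.coeff 0 (PowerSeries.coeff j (MvPowerSeries.finSuccEquiv O r (σ g))))
        rwa [MvPowerSeries.coeff_coeff_finSuccEquiv])
    exact ⟨e.symm q, hq, (MulEquiv.prime_iff e.symm.toMulEquiv).2 hqp⟩

theorem frac_key {F : Type*} [Field F] (a b c e x : F) (ha : a ≠ 0) (hb : b ≠ 0) :
    e * (c * x) = c * (a / b) * e * (b / a * x) := by
  field_simp

open TensorProduct in
theorem rank_one_dual {R M : Type*} [CommRing R] [IsDomain R] [UniqueFactorizationMonoid R]
    [AddCommGroup M] [Module R M] [Module.Finite R M]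
    (hrank : Module.finrank (FractionRing R) (FractionRing R ⊗[R] M) = 1) :
    Nonempty (R ≃ₗ[R] Module.Dual R M) := by
  classical
  let K := FractionRing R
  have hK : Function.Injective (algebraMap R K) := IsFractionRing.injective R K
  obtain ⟨b⟩ : Nonempty ((K ⊗[R] M) ≃ₗ[K] K) :=
    FiniteDimensional.nonempty_linearEquiv_of_finrank_eq (hrank.trans (Module.finrank_self K).symm)
  let ι : M →ₗ[R] K := (b.toLinearMap.restrictScalars R).comp (TensorProduct.mk R K M 1)
  have hι : ∀ m, ι m = b (1 ⊗ₜ m) := fun m => rfl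
  have hb : ∀ k m, b (k ⊗ₜ m) = k * ι m := by
    intro k m
    rw [hι, ← smul_eq_mul, ← map_smul, TensorProduct.smul_tmul', smul_eq_mul, mul_one]
  have hι0 : ∃ m, ι m ≠ 0 := by
    by_contra hcon
    push Not at hcon
    have h0 : ∀ x, b x = 0 := by
      intro x
      induction x using TensorProduct.induction_on with
      | zero => simp
      | tmul k m => rw [hb, hcon, mul_zero]
      | add x y hx hy => rw [map_add, hx, hy, add_zero]
    have := h0 (b.symm 1)
    rw [b.apply_symm_apply] at this
    exact one_ne_zero this
  obtain ⟨t, ht⟩ := Module.Finite.fg_top (R := R) (M := M)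
  have hspan : ∀ c : K, (∀ x ∈ t, c * ι x ∈ LinearMap.range (Algebra.linearMap R K)) →
      ∃ f : M →ₗ[R] R, ∀ m, algebraMap R K (f m) = c * ι m := by
    intro c hc
    let φ : M →ₗ[R] K := (LinearMap.mulLeft R c).comp ι
    have hφ : ∀ m, φ m ∈ LinearMap.range (Algebra.linearMap R K) := by
      intro m
      have hm : m ∈ Submodule.span R (t : Set M) := by rw [ht]; trivial
      have : Submodule.span R (t : Set M) ≤ (LinearMap.range (Algebra.linearMap R K)).comap φ :=
        Submodule.span_le.2 hc
      exact this hm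
    let e := LinearEquiv.ofInjective (Algebra.linearMap R K) hK
    refine ⟨e.symm.toLinearMap.comp (φ.codRestrict _ hφ), fun m => ?_⟩
    have := congrArg Subtype.val (e.apply_symm_apply (φ.codRestrict _ hφ m))
    exact this
  have hext : ∀ f : M →ₗ[R] R, ∃ c : K, ∀ m, algebraMap R K (f m) = c * ι m := by
    intro f
    let F : K ⊗[R] M →ₗ[K] K := (TensorProduct.AlgebraTensorModule.rid R K K).toLinearMap.comp
      (f.baseChange K)
    refine ⟨F (b.symm 1), fun m => ?_⟩
    have h1 : F (1 ⊗ₜ m) = algebraMap R K (f m) := by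
      simp [F, Algebra.smul_def]
    rw [← h1, mul_comm, ← smul_eq_mul, ← map_smul, ← map_smul, smul_eq_mul, mul_one, hι,
      b.symm_apply_apply]
  obtain ⟨d, hd⟩ := IsLocalization.exist_integer_multiples (nonZeroDivisors R) t (fun x => ι x)
  have hd' : ∀ x ∈ t, algebraMap R K d * ι x ∈ LinearMap.range (Algebra.linearMap R K) := by
    intro x hx
    obtain ⟨y, hy⟩ := hd x hx
    exact ⟨y, by rw [Algebra.linearMap_apply, hy, Algebra.smul_def]⟩
  obtain ⟨f₀, hf₀⟩ := hspan _ hd'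
  have hd0 : algebraMap R K d ≠ 0 := by
    simpa using nonZeroDivisors.ne_zero d.2
  have hf₀0 : ∃ x ∈ t, f₀ x ≠ 0 := by
    by_contra hcon
    push Not at hcon
    obtain ⟨m, hm⟩ := hι0
    have : f₀ = 0 := LinearMap.ext_on (s := (t : Set M)) (g := 0) ht (fun x hx => by simpa using hcon x hx)
    have h2 := hf₀ m
    rw [this, LinearMap.zero_apply, map_zero] at h2
    exact (mul_ne_zero hd0 hm) h2.symm
  let _ : StrongNormalizationMonoid R := UniqueFactorizationMonoid.strongNormalizationMonoid
  let _ : NormalizedGCDMonoid R := UniqueFactorizationMonoid.toNormalizedGCDMonoid R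
  obtain ⟨x₀, hx₀, hx₀'⟩ := hf₀0
  obtain ⟨g, hg, hg1⟩ := Finset.extract_gcd (fun x => f₀ x) ⟨x₀, hx₀⟩
  set D := t.gcd fun x => f₀ x
  have hD : D ≠ 0 := fun h => hx₀' (by rw [hg x₀ hx₀, h, zero_mul])
  have hDK : algebraMap R K D ≠ 0 := by simpa using hD
  obtain ⟨f₁, hf₁⟩ := hspan (algebraMap R K d / algebraMap R K D) (fun x hx => ⟨g x, by
    rw [Algebra.linearMap_apply, div_mul_eq_mul_div, ← hf₀, hg x hx, map_mul,
      mul_div_cancel_left₀ _ hDK]⟩)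
  have hf₁g : ∀ x ∈ t, f₁ x = g x := by
    intro x hx
    apply hK
    rw [hf₁, div_mul_eq_mul_div, ← hf₀, hg x hx, map_mul, mul_div_cancel_left₀ _ hDK]
  have hf₁0 : f₁ ≠ 0 := by
    intro h
    have := hg x₀ hx₀
    rw [← hf₁g x₀ hx₀, h, LinearMap.zero_apply, mul_zero] at this
    exact hx₀' this
  refine ⟨LinearEquiv.ofBijective (LinearMap.toSpanSingleton R (Module.Dual R M) f₁) ⟨?_, ?_⟩⟩
  · rw [injective_iff_map_eq_zero]
    intro a ha
    rw [LinearMap.toSpanSingleton_apply] at ha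
    obtain ⟨m, hm⟩ : ∃ m, f₁ m ≠ 0 := by
      by_contra hcon; push Not at hcon; exact hf₁0 (LinearMap.ext hcon)
    have := congrArg (fun F : Module.Dual R M => F m) ha
    simp only [LinearMap.smul_apply, LinearMap.zero_apply, smul_eq_mul] at this
    exact (mul_eq_zero.1 this).resolve_right hm
  · intro f
    obtain ⟨c, hc⟩ := hext f
    obtain ⟨u, v, huv, hcuv⟩ := IsFractionRing.exists_reduced_fraction (A := R)
      (c * (algebraMap R K D / algebraMap R K d))
    have hv0 : algebraMap R K v ≠ 0 := by simpa using nonZeroDivisors.ne_zero v.2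
    have hrel : ∀ m, (v : R) * f m = u * f₁ m := by
      intro m
      apply hK
      rw [map_mul, map_mul, hf₁, hc]
      rw [IsFractionRing.mk'_eq_div, div_eq_iff hv0] at hcuv
      rw [hcuv]
      exact frac_key _ _ _ _ _ hDK hd0
    have hvu : IsUnit (v : R) := by
      rw [isUnit_iff_dvd_one, ← hg1]
      refine Finset.dvd_gcd fun x hx => ?_
      rw [← hf₁g x hx]
      exact huv.symm.dvd_of_dvd_mul_left ⟨f x, (hrel x).symm⟩
    obtain ⟨w, hw⟩ := hvu.exists_left_inv
    refine ⟨w * u, ?_⟩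
    ext m
    rw [LinearMap.toSpanSingleton_apply, LinearMap.smul_apply, smul_eq_mul, mul_assoc, ← hrel,
      ← mul_assoc, hw, one_mul]

open TensorProduct in
theorem rank_one_ddual {R M : Type*} [CommRing R] [IsDomain R] [UniqueFactorizationMonoid R]
    [AddCommGroup M] [Module R M] [Module.Finite R M]
    (hrank : Module.finrank (FractionRing R) (FractionRing R ⊗[R] M) = 1) :
    Nonempty (R ≃ₗ[R] Module.Dual R (Module.Dual R M)) := by
  obtain ⟨e⟩ := rank_one_dual hrank
  exact ⟨(LinearMap.ringLmapEquivSelf R R R).symm.trans e.symm.dualMap⟩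

/-- If `M` is a finitely generated `Λ`-module of rank one (i.e.
`M ⊗_Λ Frac(Λ)` is a one-dimensional `Frac(Λ)`-vector space), then the double dual
`M** = Hom_Λ(Hom_Λ(M, Λ), Λ)` is a free `Λ`-module, necessarily of rank one. -/
theorem statement0 (p : ℕ) [Fact p.Prime] (K : Type) [Field K] [Algebra ℚ_[p] K]
    [Algebra ℤ_[p] K] [IsScalarTower ℤ_[p] ℚ_[p] K] [FiniteDimensional ℚ_[p] K]
    (r : ℕ) (hr : 1 ≤ r) (M : Type) [AddCommGroup M] [Module (IwasawaAlgebra p K r) M]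
    [Module.Finite (IwasawaAlgebra p K r) M]
    (hrank : Module.finrank (FractionRing (IwasawaAlgebra p K r))
      (TensorProduct (IwasawaAlgebra p K r) (FractionRing (IwasawaAlgebra p K r)) M) = 1) :
    Module.Free (IwasawaAlgebra p K r)
      (Module.Dual (IwasawaAlgebra p K r) (Module.Dual (IwasawaAlgebra p K r) M)) ∧
    Module.rank (IwasawaAlgebra p K r)
      (Module.Dual (IwasawaAlgebra p K r) (Module.Dual (IwasawaAlgebra p K r) M)) = 1 := by
  obtain ⟨hd, hpir, hl, hc, hne⟩ := O_props p K
  have hdom := mv_domain (O := PadicValRing p K) (σ := Fin r)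
  have hufd := mv_ufd (O := PadicValRing p K) hne r
  obtain ⟨e⟩ := rank_one_ddual hrank
  exact ⟨Module.Free.of_equiv e, by rw [← e.rank_eq, Module.rank_self]⟩
end
end

section
/- Let M be a small Λ-module. Then there is an exact sequence of Λ-modules 0 → Ext^{r+1}_Λ(Ext^{r+1}_Λ(M,Λ),Λ) → M → Ext^r_Λ(Ext^r_Λ(M,Λ),Λ) → 0. In particular, Ext^{r+1}_Λ(Ext^{r+1}_Λ(M,Λ),Λ) is isomorphic to M_fin and Ext^r_Λ(Ext^r_Λ(M,Λ),Λ) is isomorphic to M/M_fin as Λ-modules. -/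
open CategoryTheory Opposite

set_option maxHeartbeats 1000000
set_option synthInstance.maxHeartbeats 400000

noncomputable section

/-- The maximal finite submodule `M_fin` of `M`: the supremum of all submodules of
finite cardinality (for a Noetherian module over a ring with finite residue field this
supremum is itself finite). -/
noncomputable def finPart (R M : Type) [CommRing R] [AddCommGroup M] [Module R M] :
    Submodule R M :=
  sSup {N : Submodule R M | Set.Finite (N : Set M)}

/-- `Ext^n_R(M, N)` in the derived-category sense. -/
abbrev EE (R : Type) [CommRing R] (n : ℕ) (M N : Type) [AddCommGroup M] [Module R M]
    [AddCommGroup N] [Module R N] : Type :=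
  Abelian.Ext (ModuleCat.of R M) (ModuleCat.of R N) n

section Tool
variable {R : Type} [CommRing R]

lemma smul_extMk' {X Y : ModuleCat.{0} R} (P : ProjectiveResolution X) {n : ℕ}
    (f : P.complex.X n ⟶ Y) (m : ℕ) (hm : n + 1 = m) (hf : P.complex.d m n ≫ f = 0) (r : R) :
    P.extMk (r • f) m hm (by simp [hf]) = r • P.extMk f m hm hf := by
  rw [Abelian.Ext.smul_eq_comp_mk₀, P.extMk_comp_mk₀]
  congr 1; try simp

/-- comparison of the two Ext -/
lemma ext_comparison (M N : Type) [AddCommGroup M] [Module R M] [AddCommGroup N] [Module R N]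
    (n : ℕ) :
    Nonempty ((((Ext R (ModuleCat R) (n+1)).obj (op (ModuleCat.of R M))).obj (ModuleCat.of R N))
      ≃ₗ[R] EE R (n+1) M N) := by
  let X := ModuleCat.of R M
  let Y := ModuleCat.of R N
  let P := projectiveResolution X
  let K := P.complex.linearYonedaObj R Y
  let S := K.sc' n (n+1) (n+2)
  let e1 := (P.isoExt (R := R) (n+1) Y) ≪≫ K.homologyIsoSc' n (n+1) (n+2) (by simp) (by simp)
    ≪≫ S.moduleCatHomologyIso
  let φ : LinearMap.ker S.g.hom →ₗ[R] Abelian.Ext X Y (n+1) :=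
    { toFun := fun f => P.extMk (n := n+1) (f.1 : P.complex.X (n+1) ⟶ Y) (n+2) rfl f.2
      map_add' := by
        intro f g
        exact (P.add_extMk _ _ _ _ _ _).symm
      map_smul' := by
        intro r f
        exact smul_extMk' P _ _ _ f.2 r }
  have hφ : Function.Surjective φ := by
    intro α
    obtain ⟨f, hf, h⟩ := P.extMk_surjective α (n+2) rfl
    exact ⟨⟨f, hf⟩, h⟩
  have hk : LinearMap.range S.moduleCatToCycles = LinearMap.ker φ := by
    ext f
    rw [LinearMap.mem_ker]
    have := P.extMk_eq_zero_iff (n := n+1) (f.1 : P.complex.X (n+1) ⟶ Y) (n+2) rfl f.2 n rfl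
    change _ ↔ P.extMk (n := n+1) (f.1 : P.complex.X (n+1) ⟶ Y) (n+2) rfl f.2 = 0
    rw [this]
    constructor
    · rintro ⟨g, hg⟩
      exact ⟨g, congrArg Subtype.val hg⟩
    · rintro ⟨g, hg⟩
      exact ⟨g, Subtype.ext hg⟩
  exact ⟨e1.toLinearEquiv ≪≫ₗ Submodule.quotEquivOfEq _ _ hk ≪≫ₗ
    φ.quotKerEquivOfSurjective hφ⟩

variable {A B C N : Type} [AddCommGroup A] [Module R A] [AddCommGroup B] [Module R B]
  [AddCommGroup C] [Module R C] [AddCommGroup N] [Module R N]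

/-- functoriality -/
def EE.map (n : ℕ) (N : Type) [AddCommGroup N] [Module R N] (f : A →ₗ[R] B) :
    EE R n B N →ₗ[R] EE R n A N :=
  (Abelian.Ext.mk₀ (ModuleCat.ofHom f)).precompOfLinear R (ModuleCat.of R N) (zero_add n)

lemma EE.map_comp (n : ℕ) (f : A →ₗ[R] B) (g : B →ₗ[R] C) (x : EE R n C N) :
    EE.map n N (g.comp f) x = EE.map n N f (EE.map n N g x) := by
  simp only [EE.map, Abelian.Ext.bilinearCompOfLinear_apply_apply]
  rw [ModuleCat.ofHom_comp, ← Abelian.Ext.mk₀_comp_mk₀, Abelian.Ext.comp_assoc]; simp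

lemma EE.map_id (n : ℕ) (x : EE R n A N) : EE.map n N LinearMap.id x = x := by
  simp only [EE.map, Abelian.Ext.bilinearCompOfLinear_apply_apply]
  rw [ModuleCat.ofHom_id]
  simp

def EE.congr (n : ℕ) (N : Type) [AddCommGroup N] [Module R N] (e : A ≃ₗ[R] B) :
    EE R n A N ≃ₗ[R] EE R n B N :=
  LinearEquiv.ofLinearMap (EE.map n N e.symm.toLinearMap) (EE.map n N e.toLinearMap)
    (by ext x; simp [← EE.map_comp, EE.map_id]) (by ext x; simp [← EE.map_comp, EE.map_id])

lemma EE.map_smul_id (n : ℕ) (r : R) (x : EE R n A N) :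
    EE.map n N (r • LinearMap.id) x = r • x := by
  simp only [EE.map, Abelian.Ext.bilinearCompOfLinear_apply_apply]
  have : ModuleCat.ofHom (r • (LinearMap.id : A →ₗ[R] A)) = r • 𝟙 _ := rfl
  rw [this, Abelian.Ext.mk₀_smul, Abelian.Ext.smul_comp]
  simp

lemma EE.smul_eq_zero_of_forall (n : ℕ) (r : R) (h : ∀ a : A, r • a = 0) (x : EE R n A N) :
    r • x = 0 := by
  rw [← EE.map_smul_id]
  have : (r • LinearMap.id : A →ₗ[R] A) = 0 := by ext a; simp [h]
  rw [this]
  simp only [EE.map, Abelian.Ext.bilinearCompOfLinear_apply_apply]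
  have : ModuleCat.ofHom (0 : A →ₗ[R] A) = 0 := rfl
  rw [this]; simp

/-- short complex -/
abbrev sesC (f : A →ₗ[R] B) (g : B →ₗ[R] C) (h : Function.Exact f g) :
    ShortComplex (ModuleCat.{0} R) :=
  ShortComplex.mk (ModuleCat.ofHom f) (ModuleCat.ofHom g) (by ext x; exact h.apply_apply_eq_zero x)

lemma sesC_se {f : A →ₗ[R] B} {g : B →ₗ[R] C} (hf : Function.Injective f)
    (hg : Function.Surjective g) (h : Function.Exact f g) : (sesC f g h).ShortExact where
  exact := (ShortComplex.ShortExact.moduleCat_exact_iff_function_exact _).2 h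
  mono_f := (ModuleCat.mono_iff_injective _).2 hf
  epi_g := (ModuleCat.epi_iff_surjective _).2 hg

/-- connecting map -/
def EE.delta (n : ℕ) (N : Type) [AddCommGroup N] [Module R N]
    {f : A →ₗ[R] B} {g : B →ₗ[R] C} (hf : Function.Injective f)
    (hg : Function.Surjective g) (h : Function.Exact f g) : EE R n A N →ₗ[R] EE R (n+1) C N :=
  (sesC_se hf hg h).extClass.precompOfLinear R (ModuleCat.of R N) (add_comm 1 n)

section les

lemma EE.exact_mid {f : A →ₗ[R] B} {g : B →ₗ[R] C} (hf : Function.Injective f)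
    (hg : Function.Surjective g) (h : Function.Exact f g)
    (n : ℕ) : Function.Exact (EE.map n N g) (EE.map n N f) := by
  intro x
  constructor
  · intro hx
    obtain ⟨y, hy⟩ := Abelian.Ext.contravariant_sequence_exact₂ (sesC_se hf hg h) _ x hx
    exact ⟨y, hy⟩
  · rintro ⟨y, rfl⟩
    rw [← EE.map_comp]
    have : g.comp f = 0 := by ext x; exact h.apply_apply_eq_zero x
    rw [this]
    simp only [EE.map, Abelian.Ext.bilinearCompOfLinear_apply_apply]
    have : ModuleCat.ofHom (0 : A →ₗ[R] C) = 0 := rfl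
    rw [this]; simp

lemma EE.exact_left {f : A →ₗ[R] B} {g : B →ₗ[R] C} (hf : Function.Injective f)
    (hg : Function.Surjective g) (h : Function.Exact f g)
    (n : ℕ) : Function.Exact (EE.map n N f) (EE.delta n N hf hg h) := by
  intro x
  constructor
  · intro hx
    obtain ⟨y, hy⟩ := Abelian.Ext.contravariant_sequence_exact₁ (sesC_se hf hg h) _ x (add_comm 1 n) hx
    exact ⟨y, hy⟩
  · rintro ⟨y, rfl⟩
    have := (sesC_se hf hg h).extClass_comp_assoc y (h := add_comm 1 n)
    exact this

lemma EE.exact_right {f : A →ₗ[R] B} {g : B →ₗ[R] C} (hf : Function.Injective f)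
    (hg : Function.Surjective g) (h : Function.Exact f g)
    (n : ℕ) : Function.Exact (EE.delta n N hf hg h) (EE.map (n+1) N g) := by
  intro x
  constructor
  · intro hx
    obtain ⟨y, hy⟩ := Abelian.Ext.contravariant_sequence_exact₃ (sesC_se hf hg h) _ x hx
      (add_comm 1 n)
    exact ⟨y, hy⟩
  · rintro ⟨y, rfl⟩
    have := (sesC_se hf hg h).comp_extClass_assoc y (h := add_comm 1 n)
    exact this

/-- t2 -/
lemma EE.shift {f : A →ₗ[R] B} {g : B →ₗ[R] C} (hf : Function.Injective f)
    (hg : Function.Surjective g) (h : Function.Exact f g)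
    (n : ℕ) (h1 : Subsingleton (EE R n B N)) (h2 : Subsingleton (EE R (n+1) B N)) :
    Nonempty (EE R n A N ≃ₗ[R] EE R (n+1) C N) := by
  refine ⟨LinearEquiv.ofBijective (EE.delta n N hf hg h) ⟨?_, ?_⟩⟩
  · rw [injective_iff_map_eq_zero]
    intro x hx
    obtain ⟨y, rfl⟩ := (EE.exact_left hf hg h n x).1 hx
    rw [Subsingleton.elim y 0, map_zero]
  · intro x
    exact (EE.exact_right hf hg h n x).1 (Subsingleton.elim _ _)

lemma EE.isoAB {f : A →ₗ[R] B} {g : B →ₗ[R] C} (hf : Function.Injective f)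
    (hg : Function.Surjective g) (h : Function.Exact f g)
    (n : ℕ) (h1 : Subsingleton (EE R n C N)) (h2 : Subsingleton (EE R (n+1) C N)) :
    Nonempty (EE R n B N ≃ₗ[R] EE R n A N) := by
  refine ⟨LinearEquiv.ofBijective (EE.map n N f) ⟨?_, ?_⟩⟩
  · rw [injective_iff_map_eq_zero]
    intro x hx
    obtain ⟨y, rfl⟩ := (EE.exact_mid hf hg h n x).1 hx
    rw [Subsingleton.elim y 0, map_zero]
  · intro x
    exact (EE.exact_left hf hg h n x).1 (Subsingleton.elim _ _)

lemma EE.isoBC {f : A →ₗ[R] B} {g : B →ₗ[R] C} (hf : Function.Injective f)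
    (hg : Function.Surjective g) (h : Function.Exact f g)
    (n : ℕ) (h1 : Subsingleton (EE R n A N)) (h2 : Subsingleton (EE R (n+1) A N)) :
    Nonempty (EE R (n+1) C N ≃ₗ[R] EE R (n+1) B N) := by
  refine ⟨LinearEquiv.ofBijective (EE.map (n+1) N g) ⟨?_, ?_⟩⟩
  · rw [injective_iff_map_eq_zero]
    intro x hx
    obtain ⟨y, rfl⟩ := (EE.exact_right hf hg h n x).1 hx
    rw [Subsingleton.elim y 0, map_zero]
  · intro x
    exact (EE.exact_mid hf hg h (n+1) x).1 (Subsingleton.elim _ _)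

lemma EE.subsing_mid {f : A →ₗ[R] B} {g : B →ₗ[R] C} (hf : Function.Injective f)
    (hg : Function.Surjective g) (h : Function.Exact f g)
    (n : ℕ) (h1 : Subsingleton (EE R n A N)) (h2 : Subsingleton (EE R n C N)) :
    Subsingleton (EE R n B N) := by
  refine subsingleton_of_forall_eq 0 fun x => ?_
  obtain ⟨y, rfl⟩ := (EE.exact_mid hf hg h n x).1 (Subsingleton.elim _ _)
  rw [Subsingleton.elim y 0, map_zero]

/-- degree zero -/
def EE.zeroEquiv (A N : Type) [AddCommGroup A] [Module R A] [AddCommGroup N] [Module R N] :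
    EE R 0 A N ≃ₗ[R] (A →ₗ[R] N) :=
  Abelian.Ext.linearEquiv₀.trans ModuleCat.homLinearEquiv

lemma EE.map_zeroEquiv (f : A →ₗ[R] B) (x : EE R 0 B N) :
    EE.zeroEquiv A N (EE.map 0 N f x) = (EE.zeroEquiv B N x).comp f := by
  obtain ⟨φ, rfl⟩ := (EE.zeroEquiv B N).symm.surjective x
  rw [LinearEquiv.apply_symm_apply, ← LinearEquiv.eq_symm_apply]
  change Abelian.Ext.comp (Abelian.Ext.mk₀ _) (Abelian.Ext.mk₀ (ModuleCat.ofHom φ)) (zero_add 0) =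
    Abelian.Ext.mk₀ (ModuleCat.ofHom (φ.comp f))
  simp

/-- t4 -/
lemma EE.oneEquiv {f : A →ₗ[R] B} {g : B →ₗ[R] C} (hf : Function.Injective f)
    (hg : Function.Surjective g) (h : Function.Exact f g)
    (h1 : Subsingleton (EE R 1 B N)) :
    ∃ q : (A →ₗ[R] N) →ₗ[R] EE R 1 C N, Function.Surjective q ∧
      Function.Exact (LinearMap.lcomp R N f) q := by
  refine ⟨(EE.delta 0 N hf hg h).comp (EE.zeroEquiv A N).symm.toLinearMap, ?_, ?_⟩
  · intro x
    obtain ⟨y, rfl⟩ := (EE.exact_right hf hg h 0 x).1 (Subsingleton.elim _ _)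
    exact ⟨EE.zeroEquiv A N y, by simp⟩
  · intro x
    have := EE.exact_left (N := N) hf hg h 0 ((EE.zeroEquiv A N).symm x)
    refine Iff.trans this ?_
    constructor
    · rintro ⟨y, hy⟩
      refine ⟨EE.zeroEquiv B N y, ?_⟩
      have := congrArg (EE.zeroEquiv A N) hy
      rw [EE.map_zeroEquiv, LinearEquiv.apply_symm_apply] at this
      exact this
    · rintro ⟨y, hy⟩
      refine ⟨(EE.zeroEquiv B N).symm y, ?_⟩
      apply (EE.zeroEquiv A N).injective
      rw [EE.map_zeroEquiv, LinearEquiv.apply_symm_apply, LinearEquiv.apply_symm_apply]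
      exact hy

end les

lemma EE.subsing_proj (n : ℕ) [Module.Projective R A] : Subsingleton (EE R (n+1) A N) :=
  have : Projective (ModuleCat.of R A) := (IsProjective.iff_projective A).1 inferInstance
  Abelian.Ext.subsingleton_of_projective _ _ n

end Tool

section Perfect
variable {R : Type} [CommRing R]

lemma quot_iso {P N N' : Type} [AddCommGroup P] [Module R P] [AddCommGroup N] [Module R N]
    [AddCommGroup N'] [Module R N'] (q : P →ₗ[R] N) (q' : P →ₗ[R] N')
    (h : Function.Surjective q) (h' : Function.Surjective q')
    (hk : LinearMap.ker q = LinearMap.ker q') : Nonempty (N ≃ₗ[R] N') :=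
  ⟨(q.quotKerEquivOfSurjective h).symm ≪≫ₗ Submodule.quotEquivOfEq _ _ hk ≪≫ₗ
    q'.quotKerEquivOfSurjective h'⟩

lemma ker_dualMap_subtype {P X : Type} [AddCommGroup P] [Module R P] [AddCommGroup X] [Module R X]
    (p : P →ₗ[R] X) (hp : Function.Surjective p) :
    LinearMap.ker (LinearMap.ker p).subtype.dualMap = LinearMap.range p.dualMap := by
  ext φ
  constructor
  · intro h
    have h2 : LinearMap.ker p ≤ LinearMap.ker φ := by
      intro x hx
      exact LinearMap.congr_fun h ⟨x, hx⟩
    refine ⟨((LinearMap.ker p).liftQ φ h2).comp (p.quotKerEquivOfSurjective hp).symm.toLinearMap, ?_⟩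
    ext x
    have : (p.quotKerEquivOfSurjective hp).symm (p x) = Submodule.Quotient.mk x := by
      rw [LinearEquiv.symm_apply_eq]; simp
    simp [this]
  · rintro ⟨ψ, rfl⟩
    ext x
    have := x.2
    rw [LinearMap.mem_ker] at this
    simp [this]

variable {P0 P1 N C : Type} [AddCommGroup P0] [Module R P0] [AddCommGroup P1] [Module R P1]
  [AddCommGroup N] [Module R N] [AddCommGroup C] [Module R C]

lemma cokerLemma [Module.Finite R P0] [Module.Projective R P0] [Module.Finite R P1]
    [Module.Projective R P1] (g : P1 →ₗ[R] P0) (q : P0 →ₗ[R] N) (hq : Function.Surjective q)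
    (hgq : Function.Exact g q) (π : Module.Dual R P1 →ₗ[R] C) (hπ : Function.Surjective π)
    (hinj : Function.Injective g.dualMap) (hex : Function.Exact g.dualMap π) :
    Nonempty (EE R 1 C R ≃ₗ[R] N) := by
  obtain ⟨t, ht, hte⟩ := EE.oneEquiv (N := R) hinj hπ hex (EE.subsing_proj 0)
  refine quot_iso (t.comp (Module.evalEquiv R P0).toLinearMap) q
    (ht.comp (Module.evalEquiv R P0).surjective) hq ?_
  rw [hgq.linearMap_ker_eq]
  ext x
  simp only [LinearMap.mem_ker, LinearMap.comp_apply]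
  refine (hte _).trans ?_
  constructor
  · rintro ⟨φ, hφ⟩
    obtain ⟨y, rfl⟩ := (Module.evalEquiv R P1).surjective φ
    refine ⟨y, ?_⟩
    apply (Module.evalEquiv R P0).injective
    refine Eq.trans ?_ hφ
    rfl
  · rintro ⟨y, rfl⟩
    exact ⟨Module.evalEquiv R P1 y, rfl⟩

lemma EE.shiftKer {P X N : Type} [AddCommGroup P] [Module R P] [AddCommGroup X] [Module R X]
    [AddCommGroup N] [Module R N]
    (p : P →ₗ[R] X) (hp : Function.Surjective p) (n : ℕ)
    (h1 : Subsingleton (EE R n P N)) (h2 : Subsingleton (EE R (n+1) P N)) :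
    Nonempty (EE R n (LinearMap.ker p) N ≃ₗ[R] EE R (n+1) X N) :=
  EE.shift (LinearMap.ker p).injective_subtype hp (LinearMap.exact_subtype_ker_map p) n h1 h2

abbrev PdLE (R : Type) [CommRing R] (n : ℕ) (M : Type) [AddCommGroup M] [Module R M] : Prop :=
  HasProjectiveDimensionLT (ModuleCat.of R M) (n + 1)

lemma PdLE.ker {P X : Type} [AddCommGroup P] [Module R P] [AddCommGroup X] [Module R X]
    [Module.Projective R P]
    (p : P →ₗ[R] X) (hp : Function.Surjective p) (n : ℕ) (h : PdLE R (n+1) X) :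
    PdLE R n (LinearMap.ker p) := by
  have hS := sesC_se (LinearMap.ker p).injective_subtype hp (LinearMap.exact_subtype_ker_map p)
  have : Projective (ModuleCat.of R P) := (IsProjective.iff_projective P).1 inferInstance
  exact (hS.hasProjectiveDimensionLT_X₃_iff n this).1 h

lemma PdLE.proj {X : Type} [AddCommGroup X] [Module R X] (h : PdLE R 0 X) :
    Module.Projective R X :=
  (IsProjective.iff_projective X).2 (projective_iff_hasProjectiveDimensionLT_one.2 h)

lemma dualMap_surj_of_ext_one {P X : Type} [AddCommGroup P] [Module R P] [AddCommGroup X]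
    [Module R X] [Module.Projective R P] (p : P →ₗ[R] X) (hp : Function.Surjective p)
    (h : Subsingleton (EE R 1 X R)) :
    Function.Surjective (LinearMap.ker p).subtype.dualMap := by
  obtain ⟨t, ht, hte⟩ := EE.oneEquiv (N := R) (LinearMap.ker p).injective_subtype hp
    (LinearMap.exact_subtype_ker_map p) (EE.subsing_proj 0)
  intro x
  obtain ⟨y, hy⟩ := (hte x).1 (Subsingleton.elim _ _)
  exact ⟨y, hy⟩

variable [IsNoetherianRing R]

lemma perfect_aux (m : ℕ) : ∀ (X P C : Type) [AddCommGroup X] [Module R X] [Module.Finite R X]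
    [AddCommGroup P] [Module R P] [Module.Finite R P] [Module.Projective R P] [AddCommGroup C]
    [Module R C] (_ : PdLE R (m+1) X)
    (_ : ∀ i, i < m → Subsingleton (EE R (i+1) X R)) (p : P →ₗ[R] X)
    (_ : Function.Surjective p) (c : Module.Dual R P →ₗ[R] C) (_ : Function.Surjective c)
    (_ : LinearMap.ker c = LinearMap.range p.dualMap) (k : ℕ),
    Nonempty (EE R (k+1+(m+1)) (EE R (m+1) X R) R ≃ₗ[R] EE R (k+1) C R) := by
  induction m with
  | zero =>
    intro X P C _ _ _ _ _ _ _ _ _ hpd _ p hp c hc hk k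
    have hproj := (PdLE.ker p hp 0 hpd).proj
    obtain ⟨t, ht, hte⟩ := EE.oneEquiv (N := R) (LinearMap.ker p).injective_subtype hp
      (LinearMap.exact_subtype_ker_map p) (EE.subsing_proj 0)
    have hker : LinearMap.ker t = LinearMap.range (LinearMap.ker p).subtype.dualMap :=
      hte.linearMap_ker_eq
    let d : Module.Dual R P →ₗ[R] Module.Dual R (LinearMap.ker p) :=
      (LinearMap.ker p).subtype.dualMap
    have hkk : LinearMap.ker c = LinearMap.ker d := by rw [hk, ker_dualMap_subtype p hp]
    have e : C ≃ₗ[R] LinearMap.range d :=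
      (c.quotKerEquivOfSurjective hc).symm ≪≫ₗ Submodule.quotEquivOfEq _ _ hkk ≪≫ₗ
        d.quotKerEquivRange
    have e' : C ≃ₗ[R] LinearMap.ker t := e ≪≫ₗ LinearEquiv.ofEq _ _ hker.symm
    obtain ⟨s⟩ := EE.shiftKer (P := Module.Dual R (LinearMap.ker p)) (N := R) t ht (k+1)
      (EE.subsing_proj (A := Module.Dual R (LinearMap.ker p)) k)
      (EE.subsing_proj (A := Module.Dual R (LinearMap.ker p)) (k+1))
    exact ⟨s.symm ≪≫ₗ (EE.congr (k+1) R e').symm⟩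
  | succ m ih =>
    intro X P C _ _ _ _ _ _ _ _ _ hpd hext p hp c hc hk k
    have hS := dualMap_surj_of_ext_one p hp (hext 0 (by omega))
    obtain ⟨e⟩ := quot_iso c (LinearMap.ker p).subtype.dualMap hc hS
      (by rw [hk, ker_dualMap_subtype p hp])
    obtain ⟨n, p1, hp1⟩ := Module.Finite.exists_fin' R (LinearMap.ker p)
    have sh : ∀ i, Nonempty (EE R (i+1) (LinearMap.ker p) R ≃ₗ[R] EE R (i+2) X R) := fun i =>
      EE.shift (N := R) (LinearMap.ker p).injective_subtype hp
        (LinearMap.exact_subtype_ker_map p) (i+1) (EE.subsing_proj i) (EE.subsing_proj (i+1))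
    obtain ⟨u⟩ := ih (LinearMap.ker p) (Fin n → R) (Module.Dual R (Fin n → R) ⧸
      LinearMap.range p1.dualMap) (PdLE.ker p hp _ hpd)
      (fun i hi => by
        obtain ⟨s⟩ := sh i
        have := hext (i+1) (by omega)
        exact s.toEquiv.subsingleton) p1 hp1 (Submodule.mkQ _) (Submodule.mkQ_surjective _)
      (Submodule.ker_mkQ _) (k+1)
    obtain ⟨v⟩ := EE.shift (N := R) (LinearMap.dualMap_injective_of_surjective hp1)
      (Submodule.mkQ_surjective (LinearMap.range p1.dualMap))
      (LinearMap.exact_map_mkQ_range p1.dualMap) (k+1)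
      (EE.subsing_proj (A := Module.Dual R (Fin n → R)) k)
      (EE.subsing_proj (A := Module.Dual R (Fin n → R)) (k+1))
    obtain ⟨w⟩ := sh m
    have w' := EE.congr (k+1+(m+1+1)) R w.symm
    rw [show k+1+1+(m+1) = k+1+(m+1+1) by omega] at u
    exact ⟨w' ≪≫ₗ u ≪≫ₗ v.symm ≪≫ₗ (EE.congr (k+1) R e).symm⟩

lemma perfect_dual (n : ℕ) (N : Type) [AddCommGroup N] [Module R N] [Module.Finite R N]
    (hpd : PdLE R (n+1) N) (hext : ∀ i, i < n+1 → Subsingleton (EE R i N R)) :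
    Nonempty (EE R (n+1) (EE R (n+1) N R) R ≃ₗ[R] N) := by
  obtain ⟨a, p, hp⟩ := Module.Finite.exists_fin' R N
  have hN : Subsingleton (Module.Dual R N) :=
    have := hext 0 (by omega)
    (EE.zeroEquiv N R).symm.toEquiv.subsingleton
  have hinj : Function.Injective (LinearMap.ker p).subtype.dualMap := by
    rw [← LinearMap.ker_eq_bot, ker_dualMap_subtype p hp, LinearMap.range_eq_bot]
    ext x
    rw [Subsingleton.elim x 0]
    simp
  rcases n with _ | m
  · have hproj := (PdLE.ker p hp 0 hpd).proj
    obtain ⟨t, ht, hte⟩ := EE.oneEquiv (N := R) (LinearMap.ker p).injective_subtype hp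
      (LinearMap.exact_subtype_ker_map p) (EE.subsing_proj 0)
    exact cokerLemma (LinearMap.ker p).subtype p hp (LinearMap.exact_subtype_ker_map p) t ht hinj
      hte
  · have hS := dualMap_surj_of_ext_one p hp (hext 1 (by omega))
    obtain ⟨b, p1, hp1⟩ := Module.Finite.exists_fin' R (LinearMap.ker p)
    have sh : ∀ i, Nonempty (EE R (i+1) (LinearMap.ker p) R ≃ₗ[R] EE R (i+2) N R) := fun i =>
      EE.shift (N := R) (LinearMap.ker p).injective_subtype hp
        (LinearMap.exact_subtype_ker_map p) (i+1) (EE.subsing_proj i) (EE.subsing_proj (i+1))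
    obtain ⟨u⟩ := perfect_aux m (LinearMap.ker p) (Fin b → R) (Module.Dual R (Fin b → R) ⧸
      LinearMap.range p1.dualMap) (PdLE.ker p hp _ hpd)
      (fun i hi => by
        obtain ⟨s⟩ := sh i
        have := hext (i+2) (by omega)
        exact s.toEquiv.subsingleton) p1 hp1 (Submodule.mkQ _) (Submodule.mkQ_surjective _)
      (Submodule.ker_mkQ _) 0
    obtain ⟨w⟩ := sh m
    have w' := EE.congr (0+1+(m+1)) R w
    let g := (LinearMap.ker p).subtype.comp p1
    have hg : g.dualMap = p1.dualMap.comp (LinearMap.ker p).subtype.dualMap := rfl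
    have hr : LinearMap.range g.dualMap = LinearMap.range p1.dualMap := by
      rw [hg, LinearMap.range_comp_of_range_eq_top _ (LinearMap.range_eq_top.2 hS)]
    obtain ⟨v⟩ := cokerLemma (C := (Module.Dual R (Fin b → R) ⧸ LinearMap.range p1.dualMap))
      g p hp (by
        rw [LinearMap.exact_iff, LinearMap.range_comp_of_range_eq_top _
          (LinearMap.range_eq_top.2 hp1), Submodule.range_subtype]) (Submodule.mkQ _)
      (Submodule.mkQ_surjective _)
      (by
        rw [hg]
        exact (LinearMap.dualMap_injective_of_surjective hp1).comp hinj)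
      (by rw [LinearMap.exact_iff, hr, Submodule.ker_mkQ])
    rw [show 0+1+(m+1) = m+1+1 by omega] at u w'
    exact ⟨w'.symm ≪≫ₗ u ≪≫ₗ v⟩

end Perfect

section RegularRing
open scoped Pointwise
set_option linter.unusedSectionVars false
variable {R : Type} [CommRing R]

lemma EE.quot_exact {A : Type} [AddCommGroup A] [Module R A] (x : R) :
    Function.Exact (x • (LinearMap.id : A →ₗ[R] A)) (Submodule.mkQ (x • (⊤ : Submodule R A))) := by
  rw [LinearMap.exact_iff, Submodule.ker_mkQ]
  ext a
  simp [Submodule.mem_smul_pointwise_iff_exists]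

variable [IsLocalRing R] [IsNoetherianRing R]

lemma EE.finite (n : ℕ) (A L : Type) [AddCommGroup A] [Module R A] [Module.Finite R A]
    [AddCommGroup L] [Module R L] [Module.Finite R L] : Module.Finite R (EE R n A L) :=
  inferInstanceAs (Module.Finite R (Abelian.Ext _ _ n))

/-- If `x` in the maximal ideal is regular on `A` and `Ext^(n+1)(A/x, L) = 0`, then
`Ext^n(A, L) = 0`. -/
lemma EE.nakayama (n : ℕ) (A L : Type) [AddCommGroup A] [Module R A] [Module.Finite R A]
    [AddCommGroup L] [Module R L] [Module.Finite R L] (x : R)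
    (hx : x ∈ IsLocalRing.maximalIdeal R) (hreg : IsSMulRegular A x)
    (h : Subsingleton (EE R (n+1) (QuotSMulTop x A) L)) : Subsingleton (EE R n A L) := by
  have hf : Function.Injective (x • (LinearMap.id : A →ₗ[R] A)) := hreg
  have := EE.finite (R := R) n A L
  have hs : ∀ y : EE R n A L, ∃ z : EE R n A L, x • z = y := by
    intro y
    obtain ⟨z, hz⟩ := (EE.exact_left (N := L) hf (Submodule.mkQ_surjective _)
      (EE.quot_exact x) n y).1 (Subsingleton.elim (α := EE R (n+1) (QuotSMulTop x A) L) _ _)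
    exact ⟨z, by rw [← EE.map_smul_id, hz]⟩
  have htop : (⊤ : Submodule R (EE R n A L)) = ⊥ := by
    apply Submodule.eq_bot_of_le_smul_of_le_jacobson_bot (IsLocalRing.maximalIdeal R) _
      Module.Finite.fg_top
    · intro y _
      obtain ⟨z, rfl⟩ := hs y
      exact Submodule.smul_mem_smul hx trivial
    · exact IsLocalRing.maximalIdeal_le_jacobson _
  exact (Submodule.subsingleton_iff R).1 (subsingleton_of_bot_eq_top htop.symm)

lemma EE.subsing_of_subsing (n : ℕ) (A L : Type) [AddCommGroup A] [Module R A]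
    [AddCommGroup L] [Module R L] [Subsingleton A] : Subsingleton (EE R n A L) := by
  refine subsingleton_of_forall_eq 0 fun y => ?_
  have := EE.smul_eq_zero_of_forall n (1 : R) (fun a : A => Subsingleton.elim _ _) y
  rwa [one_smul] at this

lemma EE.devissage (n : ℕ) (L : Type) [AddCommGroup L] [Module R L] (I : Ideal R)
    (h : ∀ P : PrimeSpectrum R, I ≤ P.asIdeal → Subsingleton (EE R n (R ⧸ P.asIdeal) L))
    (A : Type) [AddCommGroup A] [Module R A] (hA : Module.Finite R A)
    (hI : I ≤ Module.annihilator R A) : Subsingleton (EE R n A L) := by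
  revert hI
  refine IsNoetherianRing.induction_on_isQuotientEquivQuotientPrime R hA
    (motive := fun N _ _ _ => I ≤ Module.annihilator R N → Subsingleton (EE R n N L)) ?_ ?_ ?_
  · intro N _ _ _ _ _
    exact EE.subsing_of_subsing n N L
  · intro N _ _ _ P e hI
    have := h P (by rwa [e.annihilator_eq, Ideal.annihilator_quotient] at hI)
    exact (EE.congr n L e).toEquiv.subsingleton
  · intro N1 _ _ _ N2 _ _ _ N3 _ _ _ f g hf hg hfg h1 h3 hI
    exact EE.subsing_mid hf hg hfg n (h1 (hI.trans (LinearMap.annihilator_le_of_injective f hf)))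
      (h3 (hI.trans (LinearMap.annihilator_le_of_surjective g hg)))

lemma pd_bound (d : ℕ) (h : ∀ L : Type, ∀ [AddCommGroup L] [Module R L] [Module.Finite R L],
    ∀ i, d < i → Subsingleton (EE R i (R ⧸ IsLocalRing.maximalIdeal R) L))
    (A : Type) [AddCommGroup A] [Module R A] [Module.Finite R A] : PdLE R d A := by
  apply ModuleCat.hasProjectiveDimensionLT_of_forall_finite
  intro L hL
  have key : ∀ P : PrimeSpectrum R, ∀ i, d < i → Subsingleton (EE R i (R ⧸ P.asIdeal) L) := by
    intro P
    have : WellFoundedGT (PrimeSpectrum R) :=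
      StrictMono.wellFoundedGT (f := PrimeSpectrum.asIdeal) (fun a b hab => hab)
    refine WellFoundedGT.induction (motive := fun P : PrimeSpectrum R => ∀ i, d < i →
      Subsingleton (EE R i (R ⧸ P.asIdeal) L)) P ?_
    intro P ih i hi
    by_cases hP : P.asIdeal = IsLocalRing.maximalIdeal R
    · rw [hP]; exact h L i hi
    · obtain ⟨x, hx, hxP⟩ := SetLike.exists_of_lt
        (lt_of_le_of_ne (IsLocalRing.le_maximalIdeal P.2.ne_top) hP)
      refine EE.nakayama i _ L x hx ?_ ?_
      · have : IsDomain (R ⧸ P.asIdeal) := inferInstance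
        intro a b hab
        have hx0 : (Ideal.Quotient.mk P.asIdeal x) ≠ 0 := by
          rwa [Ne, Ideal.Quotient.eq_zero_iff_mem]
        apply mul_left_cancel₀ hx0
        simpa [Algebra.smul_def] using hab
      · refine EE.devissage (i+1) L (P.asIdeal ⊔ Ideal.span {x}) ?_ _ inferInstance ?_
        · intro Q hQ
          refine ih Q ?_ (i+1) (by omega)
          refine lt_of_le_of_ne (show P.asIdeal ≤ Q.asIdeal from le_sup_left.trans hQ) ?_
          rintro rfl
          exact hxP (hQ (Ideal.mem_sup_right (Ideal.mem_span_singleton_self x)))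
        · refine sup_le ?_ ?_
          · refine le_trans ?_ (LinearMap.annihilator_le_of_surjective
              (Submodule.mkQ (x • (⊤ : Submodule R (R ⧸ P.asIdeal)))) (Submodule.mkQ_surjective _))
            rw [Ideal.annihilator_quotient]
          · rw [Ideal.span_singleton_le_iff_mem, Module.mem_annihilator]
            intro m
            obtain ⟨m, rfl⟩ := Submodule.mkQ_surjective _ m
            rw [← map_smul]
            simp only [Submodule.mkQ_apply, Submodule.Quotient.mk_eq_zero]
            exact Submodule.smul_mem_pointwise_smul _ _ _ trivial
  exact EE.devissage (d+1) L ⊥ (fun P _ => key P _ (by omega)) A inferInstance bot_le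

lemma pd_bound' (rs : List R) (reg : RingTheory.Sequence.IsRegular R rs)
    (hm : Ideal.ofList rs = IsLocalRing.maximalIdeal R)
    (A : Type) [AddCommGroup A] [Module R A] [Module.Finite R A] : PdLE R rs.length A := by
  refine pd_bound _ ?_ A
  intro L _ _ _ i hi
  have h1 := ModuleCat.projectiveDimension_quotient_eq_length.{0} rs reg
  have h2 : HasProjectiveDimensionLT
      (ModuleCat.of R (Shrink.{0} (R ⧸ Ideal.ofList rs))) (rs.length + 1) := by
    rw [← projectiveDimension_lt_iff, h1]
    exact_mod_cast Nat.lt_succ_self _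
  have e : Shrink.{0} (R ⧸ Ideal.ofList rs) ≃ₗ[R] R ⧸ IsLocalRing.maximalIdeal R :=
    (Shrink.linearEquiv R _).trans (Submodule.quotEquivOfEq _ _ hm)
  have : Subsingleton (EE R i (Shrink.{0} (R ⧸ Ideal.ofList rs)) L) :=
    HasProjectiveDimensionLT.subsingleton _ (rs.length + 1) i (by omega) _
  exact (EE.congr i L e).symm.toEquiv.subsingleton

lemma EE.subsing_of_pd {d i : ℕ} {A L : Type} [AddCommGroup A] [Module R A]
    [AddCommGroup L] [Module R L] (h : PdLE R d A) (hi : d < i) : Subsingleton (EE R i A L) :=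
  HasProjectiveDimensionLT.subsingleton _ (d + 1) i (by omega) _

lemma pd_regular {d : ℕ} {A : Type} [AddCommGroup A] [Module R A] [Module.Finite R A] (x : R)
    (hx : x ∈ IsLocalRing.maximalIdeal R) (hreg : IsSMulRegular A x)
    (h : PdLE R (d+1) (QuotSMulTop x A)) : PdLE R d A := by
  have h1 := ModuleCat.projectiveDimension_quotSMulTop_eq_succ_of_isSMulRegular
    (ModuleCat.of R A) x hreg hx
  have h2 : projectiveDimension (ModuleCat.of R (QuotSMulTop x A)) ≤ ((d+1 : ℕ) : WithBot ℕ∞) := by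
    rw [projectiveDimension_le_iff]; exact h
  have h3 := h1.symm.trans_le h2
  show HasProjectiveDimensionLE _ d
  rw [← projectiveDimension_le_iff]
  push_cast at h3
  exact (ENat.WithBot.add_le_add_one_right_iff).1 h3

end RegularRing

section FinPart
open scoped Pointwise
set_option linter.unusedSectionVars false
variable {R M : Type} [CommRing R] [AddCommGroup M] [Module R M]

lemma finPart_finite [IsNoetherianRing R] [Module.Finite R M] : ((finPart R M : Submodule R M) : Set M).Finite := by
  obtain ⟨t, ht, heq⟩ := CompleteLattice.WellFoundedGT.isSupFiniteCompact (Submodule R M)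
    {N : Submodule R M | Set.Finite (N : Set M)}
  unfold finPart
  rw [heq]
  clear heq
  classical
  induction t using Finset.induction_on with
  | empty => simp
  | insert a s _ ih =>
    rw [Finset.sup_insert, Submodule.coe_sup]
    refine Set.Finite.add (ht (by simp)) (ih ?_)
    exact fun x hx => ht (by simp [Finset.mem_coe.1 hx])

lemma finPart_quot [IsNoetherianRing R] [Module.Finite R M] (x : M ⧸ finPart R M)
    (hx : ((Submodule.span R {x} : Submodule R _) : Set (M ⧸ finPart R M)).Finite) : x = 0 := by
  obtain ⟨a, rfl⟩ := Submodule.mkQ_surjective _ x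
  have hN : ((Submodule.comap (finPart R M).mkQ (Submodule.span R {(finPart R M).mkQ a}) :
      Submodule R M) : Set M).Finite := by
    rw [Submodule.comap_coe]
    refine Set.Finite.preimage' hx ?_
    intro b _
    obtain ⟨c, rfl⟩ := Submodule.mkQ_surjective _ b
    refine ((finPart_finite (R := R) (M := M)).image (fun y => c + y)).subset ?_
    intro y hy
    refine ⟨y - c, ?_, by simp⟩
    have h2 : (finPart R M).mkQ y = (finPart R M).mkQ c := hy
    have : (finPart R M).mkQ (y - c) = 0 := by rw [map_sub, h2, sub_self]
    rwa [Submodule.mkQ_apply, Submodule.Quotient.mk_eq_zero] at this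
  have := le_sSup (show _ ∈ {N : Submodule R M | Set.Finite (N : Set M)} from hN)
  have ha : a ∈ finPart R M := this (Submodule.mem_span_singleton_self _)
  simpa using ha

lemma support_of_finite [IsLocalRing R] [Module.Finite R M] [Finite M] :
    Module.support R M ⊆ PrimeSpectrum.zeroLocus (IsLocalRing.maximalIdeal R : Set R) := by
  rw [Module.support_eq_zeroLocus]
  intro P hP
  have hP' : Module.annihilator R M ≤ P.asIdeal := hP
  have : Finite (M → M) := inferInstance
  have : Finite (AddMonoid.End M) := Finite.of_injective (fun f => (f : M → M))
    (fun f g h => AddMonoidHom.ext (congrFun h))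
  have hfin : Finite (R ⧸ Module.annihilator R M) := by
    let φ : R ⧸ Module.annihilator R M → AddMonoid.End M := (Module.toAddMonoidEnd R M).kerLift
    exact Finite.of_injective φ (RingHom.kerLift_injective (Module.toAddMonoidEnd R M))
  have : Finite (R ⧸ P.asIdeal) := Finite.of_surjective _ (Ideal.Quotient.factor_surjective hP')
  have := Finite.isDomain_to_isField (R ⧸ P.asIdeal)
  have hmax : P.asIdeal.IsMaximal := Ideal.Quotient.maximal_of_isField _ this
  exact (IsLocalRing.eq_maximalIdeal hmax).ge

lemma exists_regular [IsLocalRing R] [IsNoetherianRing R] [Module.Finite R M]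
    [Finite (R ⧸ IsLocalRing.maximalIdeal R)]
    (h : ∀ x : M, ((Submodule.span R {x} : Submodule R M) : Set M).Finite → x = 0) :
    ∃ x ∈ IsLocalRing.maximalIdeal R, IsSMulRegular M x := by
  by_contra! hcon
  have h1 : (IsLocalRing.maximalIdeal R : Set R) ⊆ ⋃ P ∈ associatedPrimes R M, (P : Set R) := by
    rw [biUnion_associatedPrimes_eq_zero_divisors]
    intro x hx
    have := hcon x hx
    rw [isSMulRegular_iff_right_eq_zero_of_smul] at this
    push Not at this
    obtain ⟨y, hy, hy0⟩ := this
    exact ⟨y, hy0, hy⟩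
  obtain ⟨P, hP, hle⟩ := (Ideal.subset_union_prime_finite (associatedPrimes.finite R M)
    (f := id) 0 0 (fun i hi _ _ => IsAssociatedPrime.isPrime hi)).1 h1
  have hPp := IsAssociatedPrime.isPrime hP
  have hPm : P = IsLocalRing.maximalIdeal R :=
    le_antisymm (IsLocalRing.le_maximalIdeal hPp.ne_top) hle
  obtain ⟨_, x, hx⟩ := isAssociatedPrime_iff.1 hP
  have hx0 : x = 0 := by
    apply h
    have hk : IsLocalRing.maximalIdeal R ≤ LinearMap.ker (LinearMap.toSpanSingleton R M x) := by
      intro a ha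
      rw [← hPm, hx, Submodule.mem_colon_singleton] at ha
      simpa using ha
    refine (Set.finite_range (Submodule.liftQ _ (LinearMap.toSpanSingleton R M x) hk)).subset ?_
    intro y hy
    obtain ⟨a, rfl⟩ := Submodule.mem_span_singleton.1 hy
    exact ⟨Submodule.Quotient.mk a, rfl⟩
  apply hPp.ne_top
  rw [hx, hx0, Ideal.eq_top_iff_one, Submodule.mem_colon_singleton]
  simp

lemma height_max [IsLocalRing R] [IsNoetherianRing R] (rs : List R)
    (hm : Ideal.ofList rs = IsLocalRing.maximalIdeal R) :
    Order.height (IsLocalRing.closedPoint R) ≤ rs.length := by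
  have h1 := Ideal.height_le_spanFinrank (IsLocalRing.maximalIdeal R) (Ideal.IsPrime.ne_top inferInstance)
  have h2 := PrimeSpectrum.height_eq_orderHeight (IsLocalRing.closedPoint R)
  rw [← h2]
  refine h1.trans ?_
  rw [← hm]
  classical
  have h3 := Submodule.spanFinrank_span_le_ncard_of_finite (R := R) (List.finite_toSet rs)
  have h4 : Set.ncard {r | r ∈ rs} ≤ rs.length := by
    have : {r | r ∈ rs} = (rs.toFinset : Set R) := by ext; simp
    rw [this, Set.ncard_coe_finset]
    exact List.toFinset_card_le rs
  exact_mod_cast h3.trans h4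

lemma support_quot [IsLocalRing R] [IsNoetherianRing R] [Module.Finite R M] (r : ℕ)
    (hh : Order.height (IsLocalRing.closedPoint R) ≤ ((r+1 : ℕ) : ℕ∞))
    (hs : ∀ P : PrimeSpectrum R, Module.annihilator R M ≤ P.asIdeal → (r : ℕ∞) ≤ Order.height P)
    (x : R) (hreg : IsSMulRegular M x) :
    Module.support R (QuotSMulTop x M) ⊆
      PrimeSpectrum.zeroLocus (IsLocalRing.maximalIdeal R : Set R) := by
  rw [Module.support_eq_zeroLocus]
  intro P hP
  have hP' : Module.annihilator R (QuotSMulTop x M) ≤ P.asIdeal := hP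
  have hMP : Module.annihilator R M ≤ P.asIdeal := le_trans
    (LinearMap.annihilator_le_of_surjective (Submodule.mkQ (x • (⊤ : Submodule R M)))
      (Submodule.mkQ_surjective _)) hP'
  have hxP : x ∈ P.asIdeal := by
    apply hP'
    rw [Module.mem_annihilator]
    intro m
    obtain ⟨m, rfl⟩ := Submodule.mkQ_surjective _ m
    rw [← map_smul]
    simp only [Submodule.mkQ_apply, Submodule.Quotient.mk_eq_zero]
    exact Submodule.smul_mem_pointwise_smul _ _ _ trivial
  obtain ⟨Q, hQ, hQP⟩ := Ideal.exists_minimalPrimes_le hMP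
  have hQa := Module.associatedPrimes.minimalPrimes_annihilator_subset_associatedPrimes R M hQ
  have hxQ : x ∉ Q := by
    intro hxQ
    have : x ∈ ⋃ P ∈ associatedPrimes R M, (P : Set R) := by
      simp only [Set.mem_iUnion]; exact ⟨Q, hQa, hxQ⟩
    rw [biUnion_associatedPrimes_eq_zero_divisors] at this
    obtain ⟨y, hy0, hy⟩ := this
    exact hy0 (isSMulRegular_iff_right_eq_zero_of_smul.1 hreg y hy)
  have hlt : (⟨Q, hQ.1.1⟩ : PrimeSpectrum R) < P :=
    lt_of_le_of_ne hQP (by rintro rfl; exact hxQ hxP)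
  have h1 := hs ⟨Q, hQ.1.1⟩ hQ.1.2
  have h2 := Order.height_add_one_le hlt
  have h3 : ((r+1 : ℕ) : ℕ∞) ≤ Order.height P := by
    push_cast
    exact le_trans (by gcongr) h2
  by_contra hne
  have hlt2 : P < IsLocalRing.closedPoint R := by
    refine lt_of_le_of_ne (IsLocalRing.le_maximalIdeal P.2.ne_top) ?_
    rintro rfl
    exact hne (le_refl (IsLocalRing.maximalIdeal R))
  have h4 := (Order.height_add_one_le hlt2).trans hh
  have h5 : ((r+1 : ℕ) : ℕ∞) + 1 ≤ ((r+1 : ℕ) : ℕ∞) := le_trans (by gcongr) h4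
  have h6 : r + 1 + 1 ≤ r + 1 := by exact_mod_cast h5
  omega

lemma depth_vanish [IsLocalRing R] [IsNoetherianRing R] (rs : List R)
    (reg : RingTheory.Sequence.IsRegular R rs)
    (hm : Ideal.ofList rs = IsLocalRing.maximalIdeal R) [Module.Finite R M]
    (h : Module.support R M ⊆ PrimeSpectrum.zeroLocus (IsLocalRing.maximalIdeal R : Set R))
    (i : ℕ) (hi : i < rs.length) : Subsingleton (EE R i M R) := by
  refine ModuleCat.subsingleton_ext_of_exists_isRegular (IsLocalRing.maximalIdeal R)
    (ModuleCat.of R M) h (ModuleCat.of R R) ?_ rs ?_ reg i hi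
  · have : IsLocalRing.maximalIdeal R • (⊤ : Submodule R R) = IsLocalRing.maximalIdeal R := by
      simp
    exact lt_of_eq_of_lt this (Ideal.IsPrime.ne_top inferInstance).lt_top
  · intro a ha
    rw [← hm]
    exact Ideal.subset_span ha

theorem abstract_main [IsLocalRing R] [IsNoetherianRing R] [Module.Finite R M]
    [Finite (R ⧸ IsLocalRing.maximalIdeal R)] (r : ℕ) (hr : 1 ≤ r) (rs : List R)
    (reg : RingTheory.Sequence.IsRegular R rs)
    (hm : Ideal.ofList rs = IsLocalRing.maximalIdeal R) (hlen : rs.length = r + 1)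
    (hs : ∀ P : PrimeSpectrum R, Module.annihilator R M ≤ P.asIdeal → (r : ℕ∞) ≤ Order.height P) :
    Nonempty (EE R (r+1) (EE R (r+1) M R) R ≃ₗ[R] finPart R M) ∧
    Nonempty (EE R r (EE R r M R) R ≃ₗ[R] (M ⧸ finPart R M)) := by
  have hFfin : Finite (finPart R M) := finPart_finite.to_subtype
  obtain ⟨x, hx, hreg⟩ := exists_regular (R := R) (M := M ⧸ finPart R M) finPart_quot
  have hF : ∀ i < r + 1, Subsingleton (EE R i (finPart R M) R) := fun i hi =>
    depth_vanish rs reg hm support_of_finite i (by omega)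
  have hs' : ∀ P : PrimeSpectrum R, Module.annihilator R (M ⧸ finPart R M) ≤ P.asIdeal →
      (r : ℕ∞) ≤ Order.height P := fun P hP => hs P (le_trans
        (LinearMap.annihilator_le_of_surjective _ (Submodule.mkQ_surjective _)) hP)
  have hQ : ∀ i < r + 1, Subsingleton (EE R i (QuotSMulTop x (M ⧸ finPart R M)) R) := fun i hi =>
    depth_vanish rs reg hm (support_quot r (hlen ▸ height_max rs hm) hs' x hreg) i (by omega)
  have hM : ∀ i < r, Subsingleton (EE R i (M ⧸ finPart R M) R) := fun i hi =>
    EE.nakayama i _ R x hx hreg (hQ (i+1) (by omega))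
  have hpdF : PdLE R (r+1) (finPart R M) := hlen ▸ pd_bound' rs reg hm _
  have hpdM : PdLE R r (M ⧸ finPart R M) := pd_regular x hx hreg (hlen ▸ pd_bound' rs reg hm _)
  have hi := (finPart R M).injective_subtype
  have hsu := (finPart R M).mkQ_surjective
  have hex := LinearMap.exact_subtype_mkQ (finPart R M)
  obtain ⟨e1⟩ := EE.isoAB (N := R) hi hsu hex (r+1) (EE.subsing_of_pd hpdM (by omega))
    (EE.subsing_of_pd hpdM (by omega))
  obtain ⟨k, rfl⟩ : ∃ k, r = k + 1 := ⟨r - 1, by omega⟩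
  obtain ⟨e2⟩ := EE.isoBC (N := R) hi hsu hex k (hF _ (by omega)) (hF _ (by omega))
  obtain ⟨d1⟩ := perfect_dual (k+1) (finPart R M) hpdF hF
  obtain ⟨d2⟩ := perfect_dual k (M ⧸ finPart R M) hpdM hM
  exact ⟨⟨EE.congr _ R e1 ≪≫ₗ d1⟩, ⟨EE.congr _ R e2.symm ≪≫ₗ d2⟩⟩

theorem abstract_final [IsLocalRing R] [IsNoetherianRing R] [Module.Finite R M]
    [Finite (R ⧸ IsLocalRing.maximalIdeal R)] (r : ℕ) (hr : 1 ≤ r) (rs : List R)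
    (reg : RingTheory.Sequence.IsRegular R rs)
    (hm : Ideal.ofList rs = IsLocalRing.maximalIdeal R) (hlen : rs.length = r + 1)
    (hsmall : (r : ℕ∞) ≤ idealHeight (Module.annihilator R M)) :
    (∃ (φ : ExtGroup R (r + 1) (ExtGroup R (r + 1) M R) R →ₗ[R] M)
      (ψ : M →ₗ[R] ExtGroup R r (ExtGroup R r M R) R),
        Function.Injective φ ∧ Function.Surjective ψ ∧
          LinearMap.range φ = LinearMap.ker ψ) ∧
    Nonempty ((ExtGroup R (r + 1) (ExtGroup R (r + 1) M R) R) ≃ₗ[R] ↥(finPart R M)) ∧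
    Nonempty ((ExtGroup R r (ExtGroup R r M R) R) ≃ₗ[R] (M ⧸ finPart R M)) := by
  have hs : ∀ P : PrimeSpectrum R, Module.annihilator R M ≤ P.asIdeal →
      (r : ℕ∞) ≤ Order.height P := fun P hP =>
    hsmall.trans (iInf_le (fun P : {P : PrimeSpectrum R // Module.annihilator R M ≤ P.asIdeal} =>
      Order.height P.1) ⟨P, hP⟩)
  obtain ⟨⟨e1⟩, ⟨e2⟩⟩ := abstract_main r hr rs reg hm hlen hs
  have key : ∀ k : ℕ, Nonempty (ExtGroup R (k + 1) (ExtGroup R (k + 1) M R) R ≃ₗ[R]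
      EE R (k+1) (EE R (k+1) M R) R) := by
    intro k
    obtain ⟨a⟩ := ext_comparison (R := R) M R k
    obtain ⟨b⟩ := ext_comparison (R := R) (ExtGroup R (k + 1) M R) R k
    exact ⟨b ≪≫ₗ EE.congr (k+1) R a⟩
  obtain ⟨k, rfl⟩ : ∃ k, r = k + 1 := ⟨r - 1, by omega⟩
  obtain ⟨c1⟩ := key (k+1)
  obtain ⟨c2⟩ := key k
  have f1 := c1 ≪≫ₗ e1
  have f2 := c2 ≪≫ₗ e2
  refine ⟨⟨(finPart R M).subtype.comp f1.toLinearMap, f2.symm.toLinearMap.comp (finPart R M).mkQ,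
    ?_, ?_, ?_⟩, ⟨f1⟩, ⟨f2⟩⟩
  · exact (finPart R M).injective_subtype.comp f1.injective
  · exact f2.symm.surjective.comp (finPart R M).mkQ_surjective
  · rw [LinearMap.range_comp_of_range_eq_top _ f1.range, LinearEquiv.ker_comp, Submodule.ker_mkQ,
      Submodule.range_subtype]

end FinPart

/-- Noetherian local ring with finite residue field and maximal ideal generated by a regular
sequence of length `d`. -/
def RegData (R : Type) [CommRing R] (d : ℕ) : Prop :=
  IsNoetherianRing R ∧ ∃ _ : IsLocalRing R, Finite (R ⧸ IsLocalRing.maximalIdeal R) ∧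
    ∃ rs : List R, RingTheory.Sequence.IsRegular R rs ∧
      Ideal.ofList rs = IsLocalRing.maximalIdeal R ∧ rs.length = d

section Padic
variable (p : ℕ) [Fact p.Prime] (K : Type) [Field K] [Algebra ℚ_[p] K]
    [Algebra ℤ_[p] K] [IsScalarTower ℤ_[p] ℚ_[p] K] [FiniteDimensional ℚ_[p] K]

lemma integral_of_spectralNorm_le (x : K) (hx : spectralNorm ℚ_[p] K x ≤ 1) :
    IsIntegral ℤ_[p] x := by
  have hint : IsIntegral ℚ_[p] x := Algebra.IsIntegral.isIntegral x
  have hmon := minpoly.monic hint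
  have h1 := (spectralValue_le_one_iff hmon).1 hx
  have hl : minpoly ℚ_[p] x ∈ Polynomial.lifts (algebraMap ℤ_[p] ℚ_[p]) := by
    rw [Polynomial.lifts_iff_coeff_lifts]
    intro n
    exact ⟨⟨_, h1 n⟩, rfl⟩
  obtain ⟨q, hq, _, hqm⟩ := Polynomial.lifts_and_natDegree_eq_and_monic hl hmon
  refine ⟨q, hqm, ?_⟩
  rw [← Polynomial.aeval_def, ← Polynomial.aeval_map_algebraMap ℚ_[p], hq, minpoly.aeval]

lemma padic_fractionRing : IsFractionRing (PadicValRing p K) K :=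
  integralClosure.isFractionRing_of_finite_extension ℚ_[p] K

lemma padic_valuationRing : ValuationRing (PadicValRing p K) := by
  have := padic_fractionRing p K
  rw [ValuationRing.iff_isInteger_or_isInteger (PadicValRing p K) K]
  intro x
  by_cases hx : x = 0
  · left; exact ⟨0, by simp [hx]⟩
  have hmul : spectralNorm ℚ_[p] K x * spectralNorm ℚ_[p] K x⁻¹ = 1 := by
    have h := map_mul (spectralMulAlgNorm ℚ_[p] K) x x⁻¹
    rw [mul_inv_cancel₀ hx, map_one] at h
    exact h.symm
  by_cases h1 : spectralNorm ℚ_[p] K x ≤ 1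
  · left; exact ⟨⟨x, integral_of_spectralNorm_le p K x h1⟩, rfl⟩
  · right
    refine ⟨⟨x⁻¹, integral_of_spectralNorm_le p K _ ?_⟩, rfl⟩
    push Not at h1
    have := spectralNorm_nonneg (K := ℚ_[p]) x⁻¹
    nlinarith

lemma padic_regData : RegData (PadicValRing p K) 1 := by
  have hv := padic_valuationRing p K
  have hfin : Module.Finite ℤ_[p] (PadicValRing p K) :=
    IsIntegralClosure.finite ℤ_[p] ℚ_[p] K (PadicValRing p K)
  have hnoeth : IsNoetherianRing (PadicValRing p K) :=
    IsNoetherianRing.of_finite ℤ_[p] _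
  have hloc : IsLocalRing (PadicValRing p K) := inferInstance
  have hinj : Function.Injective (algebraMap ℤ_[p] (PadicValRing p K)) := by
    have h0 : Function.Injective (algebraMap ℤ_[p] K) := by
      rw [IsScalarTower.algebraMap_eq ℤ_[p] ℚ_[p] K]
      exact (algebraMap ℚ_[p] K).injective.comp (IsFractionRing.injective ℤ_[p] ℚ_[p])
    intro a b hab
    exact h0 (congrArg Subtype.val hab)
  have hlh : IsLocalHom (algebraMap ℤ_[p] (PadicValRing p K)) :=
    (algebraMap_isIntegral_iff.2 inferInstance).isLocalHom hinj
  have hnf : ¬ IsField (PadicValRing p K) := by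
    rw [← Algebra.IsIntegral.isField_iff_isField hinj]
    exact IsDiscreteValuationRing.not_isField _
  have hpid : IsPrincipalIdealRing (PadicValRing p K) := inferInstance
  have hdvr : IsDiscreteValuationRing (PadicValRing p K) :=
    { not_a_field' := fun h => hnf (IsLocalRing.isField_iff_maximalIdeal_eq.2 h) }
  obtain ⟨ϖ, hϖ⟩ := IsDiscreteValuationRing.exists_irreducible (PadicValRing p K)
  refine ⟨hnoeth, hloc, ?_, [ϖ], ?_, ?_, rfl⟩
  · have : Finite (IsLocalRing.ResidueField ℤ_[p]) :=
      Finite.of_equiv _ (PadicInt.residueField (p := p)).symm.toEquiv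
    exact IsLocalRing.ResidueField.finite_of_finite this
  · rw [IsLocalRing.isRegular_iff_isWeaklyRegular_of_subset_maximalIdeal,
      RingTheory.Sequence.isWeaklyRegular_singleton_iff]
    · intro a b hab
      exact mul_left_cancel₀ hϖ.ne_zero hab
    · intro x hx
      rw [List.mem_singleton] at hx
      rw [hx, hϖ.maximalIdeal_eq]
      exact Ideal.mem_span_singleton_self _
  · rw [Ideal.ofList_singleton, ← hϖ.maximalIdeal_eq]

end Padic

section Power
variable {R S : Type} [CommRing R] [CommRing S]

lemma RegData.transport (e : R ≃+* S) {d : ℕ} (h : RegData R d) : RegData S d := by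
  obtain ⟨h1, h2, h3, rs, h4, h5, h6⟩ := h
  have hl : IsLocalRing S := e.isLocalRing
  have hmax : Ideal.map e.toRingHom (IsLocalRing.maximalIdeal R) = IsLocalRing.maximalIdeal S := by
    ext x
    obtain ⟨y, rfl⟩ := e.surjective x
    rw [Ideal.mem_map_iff_of_surjective e.toRingHom e.surjective]
    simp only [IsLocalRing.mem_maximalIdeal, mem_nonunits_iff]
    constructor
    · rintro ⟨z, hz, hzy⟩
      rw [show z = y from e.injective hzy] at hz
      simpa using hz
    · intro hy
      exact ⟨y, by simpa using hy, rfl⟩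
  refine ⟨isNoetherianRing_of_ringEquiv R e, hl, ?_, rs.map e, ?_, ?_, by simpa⟩
  · exact Finite.of_equiv _ (Ideal.quotientEquiv _ _ e hmax.symm).toEquiv
  · refine (AddEquiv.isRegular_congr (e := e.toAddEquiv) ?_).1 h4
    rw [List.forall₂_map_right_iff, List.forall₂_same]
    intro x _ y
    simp
  · rw [← hmax, ← h5, Ideal.map_ofList]; rfl

open PowerSeries in
lemma powerSeries_maximalIdeal [IsLocalRing R] :
    Ideal.span {(X : PowerSeries R)} ⊔ Ideal.map (C (R := R)) (IsLocalRing.maximalIdeal R) =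
      IsLocalRing.maximalIdeal (PowerSeries R) := by
  apply le_antisymm
  · refine sup_le ?_ ?_
    · rw [Ideal.span_singleton_le_iff_mem, IsLocalRing.mem_maximalIdeal, mem_nonunits_iff,
        PowerSeries.isUnit_iff_constantCoeff]
      simp
    · rw [Ideal.map_le_iff_le_comap]
      intro x hx
      rw [Ideal.mem_comap, IsLocalRing.mem_maximalIdeal, mem_nonunits_iff,
        PowerSeries.isUnit_iff_constantCoeff]
      simpa using hx
  · intro f hf
    rw [IsLocalRing.mem_maximalIdeal, mem_nonunits_iff,
        PowerSeries.isUnit_iff_constantCoeff] at hf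
    have h1 : X ∣ f - C (constantCoeff f) := by
      rw [X_dvd_iff]; simp
    rw [show f = (f - C (constantCoeff f)) + C (constantCoeff f) by ring]
    refine Ideal.add_mem _ (Ideal.mem_sup_left (Ideal.mem_span_singleton.2 h1))
      (Ideal.mem_sup_right (Ideal.mem_map_of_mem _ hf))

open PowerSeries in
open scoped Pointwise in
lemma RegData.power {d : ℕ} (h : RegData R d) : RegData (PowerSeries R) (d+1) := by
  obtain ⟨h1, h2, h3, rs, h4, h5, h6⟩ := h
  have hmax := powerSeries_maximalIdeal (R := R)
  have hol : Ideal.ofList (X :: rs.map (C (R := R))) = IsLocalRing.maximalIdeal (PowerSeries R) := by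
    rw [Ideal.ofList_cons, ← hmax, ← h5, Ideal.map_ofList]
  have hn : IsNoetherianRing (PowerSeries R) := inferInstance
  refine ⟨hn, inferInstance, ?_, X :: rs.map C, ?_, hol, by simpa⟩
  · have hle : ∀ x ∈ IsLocalRing.maximalIdeal R,
        ((Ideal.Quotient.mk (IsLocalRing.maximalIdeal (PowerSeries R))).comp C) x = 0 := by
      intro x hx
      rw [RingHom.comp_apply, Ideal.Quotient.eq_zero_iff_mem, ← hmax]
      exact Ideal.mem_sup_right (Ideal.mem_map_of_mem _ hx)
    refine Finite.of_surjective (Ideal.Quotient.lift _ _ hle) ?_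
    intro y
    obtain ⟨f, rfl⟩ := Ideal.Quotient.mk_surjective y
    refine ⟨Ideal.Quotient.mk _ (constantCoeff f), ?_⟩
    rw [Ideal.Quotient.lift_mk, RingHom.comp_apply, Ideal.Quotient.eq, ← hmax]
    refine Ideal.mem_sup_left (Ideal.mem_span_singleton.2 ?_)
    rw [X_dvd_iff]; simp
  · rw [IsLocalRing.isRegular_iff_isWeaklyRegular_of_subset_maximalIdeal,
      RingTheory.Sequence.isWeaklyRegular_cons_iff]
    · refine ⟨?_, ?_⟩
      · intro a b hab
        exact X_mul_cancel hab
      · let _ : Module (PowerSeries R) R := Module.compHom R (constantCoeff (R := R))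
        let φ : PowerSeries R →ₗ[PowerSeries R] R :=
          { toFun := constantCoeff
            map_add' := map_add _
            map_smul' := fun a b => map_mul _ a b }
        have hφ : Function.Surjective φ := fun x => ⟨C x, constantCoeff_C x⟩
        have hk : (X : PowerSeries R) • (⊤ : Submodule (PowerSeries R) (PowerSeries R)) =
            LinearMap.ker φ := by
          ext f
          rw [LinearMap.mem_ker, Submodule.mem_smul_pointwise_iff_exists]
          change _ ↔ constantCoeff f = 0
          rw [← X_dvd_iff]
          constructor
          · rintro ⟨g, _, rfl⟩; exact ⟨g, rfl⟩
          · rintro ⟨g, rfl⟩; exact ⟨g, trivial, rfl⟩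
        let e : QuotSMulTop (X : PowerSeries R) (PowerSeries R) ≃ₗ[PowerSeries R] R :=
          Submodule.quotEquivOfEq _ _ hk ≪≫ₗ φ.quotKerEquivOfSurjective hφ
        refine (AddEquiv.isWeaklyRegular_congr (e := e.toAddEquiv) ?_).2 h4.1
        rw [List.forall₂_map_left_iff, List.forall₂_same]
        intro x _ y
        refine (e.map_smul (C x) y).trans ?_
        change constantCoeff (C x) * _ = _
        rw [constantCoeff_C]; rfl
    · intro x hx
      rw [← hol]
      exact Ideal.subset_span hx

lemma RegData.mvPower {d : ℕ} (h : RegData R d) (n : ℕ) :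
    RegData (MvPowerSeries (Fin n) R) (d + n) := by
  induction n with
  | zero =>
    exact h.transport (MvPowerSeries.isEmptyEquiv (σ := Fin 0) (R := R)).symm.toRingEquiv
  | succ n ih =>
    exact ih.power.transport (MvPowerSeries.finSuccEquiv R n).symm.toRingEquiv

end Power

/-- For a small `Λ`-module `M` (a finitely generated module whose
annihilator has height at least `r`) there is an exact sequence of `Λ`-modules
`0 → Ext^{r+1}_Λ(Ext^{r+1}_Λ(M,Λ),Λ) → M → Ext^r_Λ(Ext^r_Λ(M,Λ),Λ) → 0`; in particular
`Ext^{r+1}_Λ(Ext^{r+1}_Λ(M,Λ),Λ) ≅ M_fin` and `Ext^r_Λ(Ext^r_Λ(M,Λ),Λ) ≅ M/M_fin`. -/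
theorem statement8 (p : ℕ) [Fact p.Prime] (K : Type) [Field K] [Algebra ℚ_[p] K]
    [Algebra ℤ_[p] K] [IsScalarTower ℤ_[p] ℚ_[p] K] [FiniteDimensional ℚ_[p] K]
    (r : ℕ) (hr : 1 ≤ r) (M : Type) [AddCommGroup M] [Module (IwasawaAlgebra p K r) M]
    [Module.Finite (IwasawaAlgebra p K r) M]
    (hsmall : (r : ℕ∞) ≤ idealHeight (Module.annihilator (IwasawaAlgebra p K r) M)) :
    (∃ (φ : ExtGroup (IwasawaAlgebra p K r) (r + 1)
        (ExtGroup (IwasawaAlgebra p K r) (r + 1) M (IwasawaAlgebra p K r))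
        (IwasawaAlgebra p K r) →ₗ[IwasawaAlgebra p K r] M)
      (ψ : M →ₗ[IwasawaAlgebra p K r] ExtGroup (IwasawaAlgebra p K r) r
        (ExtGroup (IwasawaAlgebra p K r) r M (IwasawaAlgebra p K r)) (IwasawaAlgebra p K r)),
        Function.Injective φ ∧ Function.Surjective ψ ∧
          LinearMap.range φ = LinearMap.ker ψ) ∧
    Nonempty ((ExtGroup (IwasawaAlgebra p K r) (r + 1)
        (ExtGroup (IwasawaAlgebra p K r) (r + 1) M (IwasawaAlgebra p K r))
        (IwasawaAlgebra p K r)) ≃ₗ[IwasawaAlgebra p K r]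
      ↥(finPart (IwasawaAlgebra p K r) M)) ∧
    Nonempty ((ExtGroup (IwasawaAlgebra p K r) r
        (ExtGroup (IwasawaAlgebra p K r) r M (IwasawaAlgebra p K r))
        (IwasawaAlgebra p K r)) ≃ₗ[IwasawaAlgebra p K r]
      (M ⧸ finPart (IwasawaAlgebra p K r) M)) := by
  obtain ⟨h1, h2, h3, rs, h4, h5, h6⟩ := (padic_regData p K).mvPower r
  exact abstract_final r hr rs h4 h5 (by omega) hsmall
end
end
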